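/- arXiv:2412.16550 — 5 statements merged into one kernel-verified Lean document; each statement's English description precedes it below -/
import Mathlib

section
/- Let K = ℂ(x,y) and let a vector field on ℂ² with rational coefficients be exceptional with associated minimal algebraic extension L quadratic over K, say L = K(ℓ) with ℓ² = k ∈ K, k not a square in K. Then the vector field is a rational multiple of H := ( −(h_y + ½·h·k_y/k), h_x + ½·h·k_x/k ) + Σᵢ cᵢ·(gᵢ² − k)^{−2}·( −2(−gᵢ²·g_{i,y} + k·g_{i,y} − gᵢ·k_y) − gᵢ(gᵢ² + k)·k_y/k , 2(−gᵢ²·g_{i,x} + k·g_{i,x} − gᵢ·k_x) + gᵢ(gᵢ² + k)·k_x/k ), for suitable rational functions h, g₁,…,g_m ∈ K and constants c₁,…,c_m ∈ ℂ, where subscripts x and y denote the partial derivatives ∂/∂x and ∂/∂y. -/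
noncomputable section

/-- Coefficient (w.r.t. the derivation `D`) of the one-form  Σᵢ cᵢ duᵢ/uᵢ + dv. -/
def psC {M : Type} [Field M] [CharZero M] (D : Derivation ℚ M M)
    {m : ℕ} (c u : Fin m → M) (v : M) : M :=
  (∑ i, c i * (D (u i) / u i)) + D v

/-- Prelle–Singer relation for the one-form ω = P dx + Q dy:
`(Σᵢ cᵢ duᵢ/uᵢ + dv) ∧ ω = 0` and `Σᵢ cᵢ duᵢ/uᵢ + dv ≠ 0`. -/
def PSRel {M : Type} [Field M] [CharZero M] (DX DY : Derivation ℚ M M)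
    (P Q : M) {m : ℕ} (c u : Fin m → M) (v : M) : Prop :=
  (∀ i, u i ≠ 0) ∧
  psC DX c u v * Q - psC DY c u v * P = 0 ∧
  (psC DX c u v ≠ 0 ∨ psC DY c u v ≠ 0)

variable (K : Type) [Field K] [CharZero K] [Algebra ℂ K]

/-- A finite algebraic differential extension of the differential field `(K, Dx, Dy)`. -/
structure DiffExt (Dx Dy : Derivation ℚ K K) : Type 1 where
  M : Type
  [fieldM : Field M]
  [charM : CharZero M]
  [algM : Algebra K M]
  finite : FiniteDimensional K M
  DX : Derivation ℚ M M
  DY : Derivation ℚ M M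
  extX : ∀ a : K, DX (algebraMap K M a) = algebraMap K M (Dx a)
  extY : ∀ a : K, DY (algebraMap K M a) = algebraMap K M (Dy a)

attribute [instance] DiffExt.fieldM DiffExt.charM DiffExt.algM

variable {K}

/-- A Prelle–Singer relation for ω = P dx + Q dy over the extension `E`. -/
def HasPSRel {Dx Dy : Derivation ℚ K K} (E : DiffExt K Dx Dy) (P Q : K) : Prop :=
  ∃ (m : ℕ) (c : Fin m → ℂ) (u : Fin m → E.M) (v : E.M),
    PSRel E.DX E.DY (algebraMap K E.M P) (algebraMap K E.M Q)
      (fun i => algebraMap K E.M (algebraMap ℂ K (c i))) u v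

/-- A Prelle–Singer relation for ω with all data in `K` itself. -/
def HasPSRelBase (Dx Dy : Derivation ℚ K K) (P Q : K) : Prop :=
  ∃ (m : ℕ) (c : Fin m → ℂ) (u : Fin m → K) (v : K),
    PSRel Dx Dy P Q (fun i => algebraMap ℂ K (c i)) u v

/-- ω = P dx + Q dy is exceptional: some Prelle–Singer relation holds over a finite
algebraic extension of `K`, but none holds with all data in `K` itself. -/
def IsExceptional (Dx Dy : Derivation ℚ K K) (P Q : K) : Prop :=
  (∃ E : DiffExt K Dx Dy, HasPSRel E P Q) ∧ ¬ HasPSRelBase Dx Dy P Q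

/-- A Prelle–Singer relation with all data inside the intermediate field `L`. -/
def RelIn {Dx Dy : Derivation ℚ K K} (E : DiffExt K Dx Dy) (P Q : K)
    (L : IntermediateField K E.M) : Prop :=
  ∃ (m : ℕ) (c : Fin m → ℂ) (u : Fin m → E.M) (v : E.M),
    (∀ i, u i ∈ L) ∧ v ∈ L ∧
    PSRel E.DX E.DY (algebraMap K E.M P) (algebraMap K E.M Q)
      (fun i => algebraMap K E.M (algebraMap ℂ K (c i))) u v

/-- First component (coefficient of ∂/∂x) of the vector field H of Proposition `quadprop`. -/
def Hcomp1 {K : Type} [Field K] [CharZero K] (Dy : Derivation ℚ K K)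
    (k h : K) {m : ℕ} (c g : Fin m → K) : K :=
  -(Dy h + (1/2 : K) * h * (Dy k / k)) +
  ∑ i, c i * ((g i ^ 2 - k)⁻¹ ^ 2 *
    (-(2 * (-(g i ^ 2) * Dy (g i) + k * Dy (g i) - g i * Dy k))
      - g i * (g i ^ 2 + k) * (Dy k / k)))

/-- Second component (coefficient of ∂/∂y) of the vector field H of Proposition `quadprop`. -/
def Hcomp2 {K : Type} [Field K] [CharZero K] (Dx : Derivation ℚ K K)
    (k h : K) {m : ℕ} (c g : Fin m → K) : K :=
  (Dx h + (1/2 : K) * h * (Dx k / k)) +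
  ∑ i, c i * ((g i ^ 2 - k)⁻¹ ^ 2 *
    (2 * (-(g i ^ 2) * Dx (g i) + k * Dx (g i) - g i * Dx k)
      + g i * (g i ^ 2 + k) * (Dx k / k)))

section QuadraticExtension

variable {K M : Type} [Field K]

theorem norm_ne_zero_of_not_isSquare {a b k : K} (hk : ¬ IsSquare k) (hab : ¬ (a = 0 ∧ b = 0)) :
    a ^ 2 - b ^ 2 * k ≠ 0 := by
  intro h
  by_cases hb : b = 0
  · subst hb
    exact hab ⟨by simpa using h, rfl⟩
  · refine hk ⟨a / b, ?_⟩
    field_simp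
    linear_combination -h

theorem exists_smul_eq_of_wedge_eq_zero {A B P Q : K} (h : A * Q - B * P = 0)
    (hAB : A ≠ 0 ∨ B ≠ 0) : ∃ r, P = r * A ∧ Q = r * B := by
  rcases hAB with hA | hB
  · exact ⟨P / A, by field_simp, by field_simp; linear_combination h⟩
  · exact ⟨Q / B, by field_simp; linear_combination -h, by field_simp⟩

variable [CharZero K] [Field M] [CharZero M] [Algebra K M]

theorem exists_eq_add_mul_of_mem_adjoin_sqrt {ℓ : M} {k : K}
    (hk : ℓ ^ 2 = algebraMap K M k) {z : M} (hz : z ∈ IntermediateField.adjoin K {ℓ}) :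
    ∃ a b : K, z = algebraMap K M a + algebraMap K M b * ℓ := by
  induction hz using IntermediateField.adjoin_induction with
  | mem z hz =>
    rw [Set.mem_singleton_iff] at hz
    exact ⟨0, 1, by simp [hz]⟩
  | algebraMap a => exact ⟨a, 0, by simp⟩
  | add z w _ _ hz hw =>
    obtain ⟨a, b, rfl⟩ := hz
    obtain ⟨a', b', rfl⟩ := hw
    exact ⟨a + a', b + b', by simp only [map_add]; ring⟩
  | mul z w _ _ hz hw =>
    obtain ⟨a, b, rfl⟩ := hz
    obtain ⟨a', b', rfl⟩ := hw
    refine ⟨a * a' + b * b' * k, a * b' + a' * b, ?_⟩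
    simp only [map_add, map_mul, ← hk]
    ring
  | inv z _ hz =>
    obtain ⟨a, b, rfl⟩ := hz
    by_cases h0 : algebraMap K M a + algebraMap K M b * ℓ = 0
    · exact ⟨0, 0, by simp [h0]⟩
    by_cases h1 : algebraMap K M a - algebraMap K M b * ℓ = 0
    · refine ⟨(2 * a)⁻¹, 0, ?_⟩
      rw [← sub_eq_zero.mp h1]
      simp [two_mul]
    · refine ⟨a * (a ^ 2 - b ^ 2 * k)⁻¹, -b * (a ^ 2 - b ^ 2 * k)⁻¹, ?_⟩
      have hN : algebraMap K M a ^ 2 - algebraMap K M b ^ 2 * ℓ ^ 2 =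
          (algebraMap K M a + algebraMap K M b * ℓ) *
            (algebraMap K M a - algebraMap K M b * ℓ) := by ring
      simp only [map_sub, map_mul, map_pow, map_inv₀, map_neg, ← hk, hN]
      field_simp
      ring

theorem eq_zero_of_add_mul_sqrt_eq_zero {ℓ : M} {k : K} (hk : ℓ ^ 2 = algebraMap K M k)
    (hksq : ¬ IsSquare k) {a b : K} (h : algebraMap K M a + algebraMap K M b * ℓ = 0) :
    a = 0 ∧ b = 0 := by
  by_contra hab
  refine norm_ne_zero_of_not_isSquare hksq hab ((algebraMap K M).injective ?_)
  simp only [map_sub, map_mul, map_pow, map_zero, ← hk]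
  linear_combination (algebraMap K M a - algebraMap K M b * ℓ) * h

variable {D₀ : Derivation ℚ K K} {D : Derivation ℚ M M}

theorem derivation_sqrt (hD : ∀ a, D (algebraMap K M a) = algebraMap K M (D₀ a))
    {ℓ : M} {k : K} (hk : ℓ ^ 2 = algebraMap K M k) (hk0 : k ≠ 0) :
    D ℓ = algebraMap K M (D₀ k / (2 * k)) * ℓ := by
  have hℓ : ℓ ≠ 0 := by
    rintro rfl
    exact hk0 ((algebraMap K M).injective (by rw [← hk]; simp))
  have h := hD k
  rw [← hk, pow_two, D.leibniz, smul_eq_mul] at h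
  simp only [map_div₀, map_mul, map_ofNat, ← hk, ← h]
  field_simp
  ring

theorem derivation_add_mul_sqrt (hD : ∀ a, D (algebraMap K M a) = algebraMap K M (D₀ a))
    {ℓ : M} {k : K} (hk : ℓ ^ 2 = algebraMap K M k) (hk0 : k ≠ 0) (a b : K) :
    D (algebraMap K M a + algebraMap K M b * ℓ) =
      algebraMap K M (D₀ a) + algebraMap K M (D₀ b + b * (D₀ k / (2 * k))) * ℓ := by
  rw [map_add, D.leibniz, derivation_sqrt hD hk hk0, hD, hD]
  simp only [map_add, map_mul, smul_eq_mul]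
  ring

theorem logDeriv_add_mul_sqrt (hD : ∀ a, D (algebraMap K M a) = algebraMap K M (D₀ a))
    {ℓ : M} {k : K} (hk : ℓ ^ 2 = algebraMap K M k) (hksq : ¬ IsSquare k) {a b : K}
    (hu : algebraMap K M a + algebraMap K M b * ℓ ≠ 0) :
    D (algebraMap K M a + algebraMap K M b * ℓ) / (algebraMap K M a + algebraMap K M b * ℓ) =
      algebraMap K M (1 / 2 * (D₀ (a ^ 2 - b ^ 2 * k) / (a ^ 2 - b ^ 2 * k))) +
      algebraMap K M (1 / 2 * (((a / b) ^ 2 - k)⁻¹ ^ 2 *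
        (2 * (-((a / b) ^ 2) * D₀ (a / b) + k * D₀ (a / b) - a / b * D₀ k)
          + a / b * ((a / b) ^ 2 + k) * (D₀ k / k)))) * ℓ := by
  have hk0 : k ≠ 0 := by rintro rfl; exact hksq ⟨0, by simp⟩
  have hab : ¬ (a = 0 ∧ b = 0) := by rintro ⟨rfl, rfl⟩; simp at hu
  have hN := norm_ne_zero_of_not_isSquare hksq hab
  have hcoef : 1 / 2 * (((a / b) ^ 2 - k)⁻¹ ^ 2 *
        (2 * (-((a / b) ^ 2) * D₀ (a / b) + k * D₀ (a / b) - a / b * D₀ k)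
          + a / b * ((a / b) ^ 2 + k) * (D₀ k / k))) =
      (a * (D₀ b + b * (D₀ k / (2 * k))) - D₀ a * b) / (a ^ 2 - b ^ 2 * k) := by
    by_cases hb : b = 0
    · simp [hb]
    · have h1 : (a / b) ^ 2 - k = (a ^ 2 - b ^ 2 * k) / b ^ 2 := by field_simp
      have h2 : D₀ (a / b) = (D₀ a * b - a * D₀ b) / b ^ 2 := by
        rw [Derivation.leibniz_div]
        simp only [smul_eq_mul]
        field_simp
      rw [h1, h2]
      field_simp
      ring
  have hnorm : D₀ (a ^ 2 - b ^ 2 * k) =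
      2 * a * D₀ a - 2 * b * D₀ b * k - b ^ 2 * D₀ k := by
    simp only [map_sub, pow_two, D₀.leibniz, smul_eq_mul]
    ring
  rw [hcoef, hnorm, derivation_add_mul_sqrt hD hk hk0, div_eq_iff hu]
  have hN' : algebraMap K M (a ^ 2 - b ^ 2 * k) ≠ 0 := (map_ne_zero _).mpr hN
  have hk' : algebraMap K M k ≠ 0 := by simpa using hk0
  simp only [map_sub, map_mul, map_pow] at hN'
  simp only [map_add, map_sub, map_mul, map_div₀, map_pow, map_ofNat, map_one]
  field_simp
  ring_nf
  simp only [hk]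
  ring

theorem psC_add_mul_sqrt (hD : ∀ a, D (algebraMap K M a) = algebraMap K M (D₀ a))
    {ℓ : M} {k : K} (hk : ℓ ^ 2 = algebraMap K M k) (hksq : ¬ IsSquare k)
    {m : ℕ} (c a b : Fin m → K) (v w : K)
    (hu : ∀ i, algebraMap K M (a i) + algebraMap K M (b i) * ℓ ≠ 0) :
    psC D (fun i => algebraMap K M (c i))
        (fun i => algebraMap K M (a i) + algebraMap K M (b i) * ℓ)
        (algebraMap K M v + algebraMap K M w * ℓ) =
      algebraMap K M (1 / 2 * psC D₀ c (fun i => a i ^ 2 - b i ^ 2 * k) (2 * v)) +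
      algebraMap K M (1 / 2 * Hcomp2 D₀ k (2 * w) c (fun i => a i / b i)) * ℓ := by
  have hk0 : k ≠ 0 := by rintro rfl; exact hksq ⟨0, by simp⟩
  have h2 : ∀ t : K, D₀ (2 * t) = 2 * D₀ t := fun t => by
    rw [two_mul, map_add, two_mul]
  unfold psC Hcomp2
  have hsum (X Y : Fin m → K) : ∑ i, algebraMap K M (c i) *
      (algebraMap K M (1 / 2 * X i) + algebraMap K M (1 / 2 * Y i) * ℓ) =
      algebraMap K M (1 / 2 * ∑ i, c i * X i) + algebraMap K M (1 / 2 * ∑ i, c i * Y i) * ℓ := by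
    rw [Finset.mul_sum, Finset.mul_sum, map_sum, map_sum, Finset.sum_mul, ← Finset.sum_add_distrib]
    refine Finset.sum_congr rfl fun i _ => ?_
    simp only [map_mul]
    ring
  rw [Finset.sum_congr rfl fun i _ => by rw [logDeriv_add_mul_sqrt hD hk hksq (hu i)], hsum,
    derivation_add_mul_sqrt hD hk hk0, h2, h2]
  have hhalf : 1 / 2 * (2 * D₀ v) = D₀ v := by ring
  have hhalf' : D₀ w + w * (D₀ k / (2 * k)) =
      1 / 2 * (2 * D₀ w + 1 / 2 * (2 * w) * (D₀ k / k)) := by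
    field_simp
  rw [hhalf']
  simp only [mul_add, map_add]
  rw [hhalf]
  ring

theorem Hcomp1_eq_neg_Hcomp2 (k h : K) {m : ℕ} (c g : Fin m → K) :
    Hcomp1 D₀ k h c g = -Hcomp2 D₀ k h c g := by
  unfold Hcomp1 Hcomp2
  rw [neg_add (D₀ h + _), ← Finset.sum_neg_distrib]
  congr 1
  exact Finset.sum_congr rfl fun i _ => by ring

end QuadraticExtension

/-- Proposition `quadprop`(a). Every exceptional vector field in
dimension two whose minimal extension is quadratic, L = K(ℓ) with ℓ² = k not a square
in K, is a rational multiple of the vector field H built from rational functions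
h, g₁, …, g_m and constants c₁, …, c_m ∈ ℂ. -/
theorem exceptional_quadratic_is_multiple_of_H
    {K : Type} [Field K] [CharZero K] [Algebra ℂ K]
    (x y : K) (Dx Dy : Derivation ℚ K K)
    (hxx : Dx x = 1) (hxy : Dx y = 0) (hyx : Dy x = 0) (hyy : Dy y = 1)
    (hDxC : ∀ z : ℂ, Dx (algebraMap ℂ K z) = 0)
    (hDyC : ∀ z : ℂ, Dy (algebraMap ℂ K z) = 0)
    (hcomm : ∀ a : K, Dx (Dy a) = Dy (Dx a))
    (hgen : IntermediateField.adjoin ℂ {x, y} = ⊤)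
    (hind : AlgebraicIndependent ℂ ![x, y])
    (P Q : K) (hω : ¬ (P = 0 ∧ Q = 0))
    (hexc : IsExceptional Dx Dy P Q)
    {E : DiffExt K Dx Dy} (ℓ : E.M) (k : K)
    (hk : ℓ ^ 2 = algebraMap K E.M k) (hksq : ¬ IsSquare k)
    (hmin : Minimal (RelIn E P Q) (IntermediateField.adjoin K {ℓ})) :
    ∃ (r h : K) (m' : ℕ) (c : Fin m' → ℂ) (g : Fin m' → K),
      -Q = r * Hcomp1 Dy k h (fun i => algebraMap ℂ K (c i)) g ∧
      P = r * Hcomp2 Dx k h (fun i => algebraMap ℂ K (c i)) g := by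
  obtain ⟨m, c, u, v, hu, hv, hu0, hwedge, hne⟩ := hmin.prop
  choose a b hab using fun i => exists_eq_add_mul_of_mem_adjoin_sqrt hk (hu i)
  obtain ⟨p, q, rfl⟩ := exists_eq_add_mul_of_mem_adjoin_sqrt hk hv
  obtain rfl : u = fun i => algebraMap K E.M (a i) + algebraMap K E.M (b i) * ℓ := funext hab
  have hN : ∀ i, a i ^ 2 - b i ^ 2 * k ≠ 0 := fun i =>
    norm_ne_zero_of_not_isSquare hksq fun h => hu0 i (by simp [h.1, h.2])
  rw [psC_add_mul_sqrt E.extX hk hksq _ _ _ _ _ hu0,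
    psC_add_mul_sqrt E.extY hk hksq _ _ _ _ _ hu0] at hwedge hne
  set Ax := psC Dx (fun i => algebraMap ℂ K (c i)) (fun i => a i ^ 2 - b i ^ 2 * k) (2 * p)
  set Ay := psC Dy (fun i => algebraMap ℂ K (c i)) (fun i => a i ^ 2 - b i ^ 2 * k) (2 * p)
  set Bx := Hcomp2 Dx k (2 * q) (fun i => algebraMap ℂ K (c i)) (fun i => a i / b i)
  set By := Hcomp2 Dy k (2 * q) (fun i => algebraMap ℂ K (c i)) (fun i => a i / b i) with hBy
  obtain ⟨hA, hB⟩ := eq_zero_of_add_mul_sqrt_eq_zero hk hksq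
    (a := 1 / 2 * (Ax * Q - Ay * P)) (b := 1 / 2 * (Bx * Q - By * P)) (by
      rw [← hwedge]
      simp only [map_mul, map_sub]
      ring)
  have hA0 : Ax = 0 ∧ Ay = 0 := by
    by_contra h
    exact hexc.2 ⟨m, c, _, _, hN, by simpa using hA, not_and_or.mp h⟩
  have hB0 : Bx ≠ 0 ∨ By ≠ 0 := by
    by_contra! h
    simp [hA0, h] at hne
  obtain ⟨r, hP, hQ⟩ := exists_smul_eq_of_wedge_eq_zero
    (show Bx * Q - By * P = 0 by simpa using hB) hB0
  refine ⟨r, 2 * q, m, c, fun i => a i / b i, ?_, hP⟩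
  rw [Hcomp1_eq_neg_Hcomp2, ← hBy, hQ]
  ring
end
end

section
/- Let K = ℂ(x,y) and let L = K(ℓ) with ℓⁿ = k ∈ K be a Galois extension of K of degree n with cyclic Galois group generated by τ, τ(ℓ) = ζℓ for a primitive n-th root of unity ζ. Let γ̃ = dṽ + Σᵢ c̃ᵢ dũᵢ/ũᵢ, where ṽ ∈ L has trace Tr_{L/K}(ṽ) = 0, each ũᵢ ∈ L∖{0} has norm N_{L/K}(ũᵢ) = 1, and c̃ᵢ ∈ ℂ. Then γ := Pr(γ̃) (the projection Pr(ξ) = (1/n)Σ_{j=0}^{n−1} ζ^{−j}τ^j(ξ) applied coefficientwise) can be written as γ = dv + Σᵢ cᵢ duᵢ/uᵢ with v ∈ L of trace zero, uᵢ ∈ L∖{0} of norm one, and cᵢ ∈ ℂ; and furthermore γ = ℓ·ω for some one-form ω with coefficients in K. -/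
noncomputable section

variable (K : Type) [Field K] [CharZero K] [Algebra ℂ K]

variable {K}

/-- The averaging map Pr(ξ) = (1/n) Σ_{j<n} ζ^{−j} τ^j(ξ). -/
def PrMap {K L : Type} [Field K] [Field L] [Algebra K L]
    (τ : L ≃ₐ[K] L) (ζ : K) (n : ℕ) (ξ : L) : L :=
  (n : L)⁻¹ * ∑ j ∈ Finset.range n, ((algebraMap K L ζ) ^ j)⁻¹ * ((τ ^ j) ξ)

/-- A derivation of a separable algebraic extension that preserves the base field, where it is
given by `d`, commutes with every automorphism over the base field. -/
theorem derivation_comm_algEquiv {K M : Type} [Field K] [Field M] [CharZero M] [Algebra K M]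
    [Algebra.IsSeparable K M] (D : Derivation ℚ M M) (d : K → K)
    (hD : ∀ a : K, D (algebraMap K M a) = algebraMap K M (d a)) (σ : M ≃ₐ[K] M) (z : M) :
    D (σ z) = σ (D z) := by
  have hmul : ∀ a b : M, σ.symm (D (σ (a * b))) - D (a * b)
      = a * (σ.symm (D (σ b)) - D b) + b * (σ.symm (D (σ a)) - D a) := by
    intro a b
    simp only [map_mul, Derivation.leibniz, smul_eq_mul, map_add, AlgEquiv.symm_apply_apply]
    ring
  have hbase : ∀ a : K, σ.symm (D (σ (algebraMap K M a))) - D (algebraMap K M a) = 0 := by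
    intro a
    simp [hD]
  let δ : Derivation K M M := Derivation.mk'
    { toFun := fun w => σ.symm (D (σ w)) - D w
      map_add' := fun a b => by simp only [map_add]; ring
      map_smul' := fun a b => by
        simp only [Algebra.smul_def, RingHom.id_apply]
        rw [hmul, hbase, mul_zero, add_zero] }
    hmul
  have : Algebra.FormallyUnramified K M := Algebra.FormallyUnramified.of_isSeparable K M
  have hδ : δ = 0 := by
    rw [← Derivation.liftKaehlerDifferential_comp δ,
      Subsingleton.elim δ.liftKaehlerDifferential 0]
    ext
    simp
  have hz : σ.symm (D (σ z)) - D z = 0 := DFunLike.congr_fun hδ z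
  rw [← sub_eq_zero.mp hz, AlgEquiv.apply_symm_apply]

/-- The averaging map takes values in the `ζ`-eigenspace of `τ`. -/
theorem apply_PrMap {K L : Type} [Field K] [Field L] [Algebra K L]
    (τ : L ≃ₐ[K] L) {ζ : K} {n : ℕ} (hζ0 : ζ ≠ 0) (hζ : ζ ^ n = 1) (hτ : τ ^ n = 1) (ξ : L) :
    τ (PrMap τ ζ n ξ) = algebraMap K L ζ * PrMap τ ζ n ξ := by
  have hz0 : algebraMap K L ζ ≠ 0 := by simpa using hζ0
  have hzn : algebraMap K L ζ ^ n = 1 := by rw [← map_pow, hζ, map_one]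
  have hshift : ∑ j ∈ Finset.range n, ((algebraMap K L ζ) ^ (j + 1))⁻¹ * ((τ ^ (j + 1)) ξ)
      = ∑ j ∈ Finset.range n, ((algebraMap K L ζ) ^ j)⁻¹ * ((τ ^ j) ξ) := by
    have h := Finset.sum_range_succ'
      (fun j => ((algebraMap K L ζ) ^ j)⁻¹ * ((τ ^ j) ξ)) n
    rw [Finset.sum_range_succ] at h
    simpa [hzn, hτ] using h.symm
  unfold PrMap
  conv_rhs => rw [← hshift]
  rw [map_mul τ, map_sum τ, map_inv₀ τ, map_natCast τ, mul_left_comm,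
    Finset.mul_sum _ _ (algebraMap K L ζ)]
  congr 1
  refine Finset.sum_congr rfl fun j _ => ?_
  rw [map_mul, map_inv₀, map_pow, AlgEquiv.commutes, pow_succ', pow_succ', AlgEquiv.mul_apply]
  field_simp

/-- The averaging map sends logarithmic-plus-exact one-forms to one-forms of the same shape. -/
theorem PrMap_psC {K M : Type} [Field K] [Field M] [CharZero M] [Algebra K M]
    (D : Derivation ℚ M M) (τ : M ≃ₐ[K] M) (hcomm : ∀ j : ℕ, ∀ z, D ((τ ^ j) z) = (τ ^ j) (D z))
    {ζ : K} (hζ : D (algebraMap K M ζ) = 0) (n : ℕ) {m : ℕ} (c : Fin m → K)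
    (u : Fin m → M) (v : M) :
    PrMap τ ζ n (psC D (fun i => algebraMap K M (c i)) u v)
      = psC D (fun p : Fin (m * n) => algebraMap K M
            ((n : K)⁻¹ * (ζ ^ ((finProdFinEquiv.symm p).2 : ℕ))⁻¹ * c (finProdFinEquiv.symm p).1))
          (fun p => (τ ^ ((finProdFinEquiv.symm p).2 : ℕ)) (u (finProdFinEquiv.symm p).1))
          (PrMap τ ζ n v) := by
  have hpow : ∀ j : ℕ, D (((algebraMap K M ζ) ^ j)⁻¹) = 0 := fun j => by
    simp [Derivation.leibniz_inv, Derivation.leibniz_pow, hζ]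
  have hn : D ((n : M)⁻¹) = 0 := by simp [Derivation.leibniz_inv]
  have hv : D (PrMap τ ζ n v) = PrMap τ ζ n (D v) := by
    simp only [PrMap, Derivation.leibniz, smul_eq_mul, hpow, hn, hcomm, map_sum, mul_zero, add_zero]
  unfold psC
  rw [hv, finProdFinEquiv.symm.sum_comp (fun q : Fin m × Fin n =>
    algebraMap K M ((n : K)⁻¹ * (ζ ^ (q.2 : ℕ))⁻¹ * c q.1)
      * (D ((τ ^ (q.2 : ℕ)) (u q.1)) / (τ ^ (q.2 : ℕ)) (u q.1))), Fintype.sum_prod_type_right]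
  unfold PrMap
  simp only [map_add, mul_add, Finset.sum_add_distrib]
  congr 1
  rw [← Fin.sum_univ_eq_sum_range
    (fun j => ((algebraMap K M ζ) ^ j)⁻¹ * (τ ^ j) (∑ i, algebraMap K M (c i) * (D (u i) / u i))),
    Finset.mul_sum]
  refine Finset.sum_congr rfl fun j _ => ?_
  rw [map_sum, Finset.mul_sum, Finset.mul_sum]
  refine Finset.sum_congr rfl fun i _ => ?_
  simp only [map_mul, map_div₀, map_inv₀, map_pow, map_natCast, AlgEquiv.commutes, hcomm]
  ring

/-- Projecting γ̃ = dṽ + Σ c̃ᵢ dũᵢ/ũᵢ (ṽ of trace zero, ũᵢ of norm one)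
by Pr yields a one-form γ of the same shape (trace-zero and norm-one data) which moreover
equals ℓ·ω for a one-form ω over K. -/
theorem projection_of_trace_zero_norm_one_form
    {K : Type} [Field K] [CharZero K] [Algebra ℂ K]
    (x y : K) (Dx Dy : Derivation ℚ K K)
    (hxx : Dx x = 1) (hxy : Dx y = 0) (hyx : Dy x = 0) (hyy : Dy y = 1)
    (hDxC : ∀ z : ℂ, Dx (algebraMap ℂ K z) = 0)
    (hDyC : ∀ z : ℂ, Dy (algebraMap ℂ K z) = 0)
    (hcomm : ∀ a : K, Dx (Dy a) = Dy (Dx a))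
    (hgen : IntermediateField.adjoin ℂ {x, y} = ⊤)
    (hind : AlgebraicIndependent ℂ ![x, y])
    {E : DiffExt K Dx Dy} (hGal : IsGalois K E.M)
    (n : ℕ) (hn : 0 < n) (hrank : Module.finrank K E.M = n)
    (ℓ : E.M) (k : K) (hℓn : ℓ ^ n = algebraMap K E.M k)
    (hgenℓ : IntermediateField.adjoin K {ℓ} = ⊤)
    (τ : E.M ≃ₐ[K] E.M) (hτgen : ∀ σ : E.M ≃ₐ[K] E.M, σ ∈ Subgroup.zpowers τ)
    (ζ : ℂ) (hζ : IsPrimitiveRoot ζ n)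
    (hτℓ : τ ℓ = algebraMap K E.M (algebraMap ℂ K ζ) * ℓ)
    (mt : ℕ) (ct : Fin mt → ℂ) (ut : Fin mt → E.M) (vt : E.M)
    (hut0 : ∀ i, ut i ≠ 0)
    (htr : Algebra.trace K E.M vt = 0)
    (hnm : ∀ i, Algebra.norm K (ut i) = 1) :
    ∃ (m' : ℕ) (c' : Fin m' → ℂ) (u' : Fin m' → E.M) (v' : E.M),
      (∀ i, u' i ≠ 0) ∧
      Algebra.trace K E.M v' = 0 ∧
      (∀ i, Algebra.norm K (u' i) = 1) ∧
      PrMap τ (algebraMap ℂ K ζ) n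
          (psC E.DX (fun i => algebraMap K E.M (algebraMap ℂ K (ct i))) ut vt)
        = psC E.DX (fun i => algebraMap K E.M (algebraMap ℂ K (c' i))) u' v' ∧
      PrMap τ (algebraMap ℂ K ζ) n
          (psC E.DY (fun i => algebraMap K E.M (algebraMap ℂ K (ct i))) ut vt)
        = psC E.DY (fun i => algebraMap K E.M (algebraMap ℂ K (c' i))) u' v' ∧
      ∃ P Q : K,
        PrMap τ (algebraMap ℂ K ζ) n
            (psC E.DX (fun i => algebraMap K E.M (algebraMap ℂ K (ct i))) ut vt)
          = ℓ * algebraMap K E.M P ∧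
        PrMap τ (algebraMap ℂ K ζ) n
            (psC E.DY (fun i => algebraMap K E.M (algebraMap ℂ K (ct i))) ut vt)
          = ℓ * algebraMap K E.M Q := by
  have hfin : FiniteDimensional K E.M := E.finite
  set z : K := algebraMap ℂ K ζ with hz
  have hz0 : z ≠ 0 := by simpa [hz] using hζ.ne_zero hn.ne'
  have hzn : z ^ n = 1 := by rw [hz, ← map_pow, hζ.pow_eq_one, map_one]
  have hτn : τ ^ n = 1 := by
    rw [← hrank, ← IsGalois.card_aut_eq_finrank K E.M]
    exact pow_card_eq_one'
  have hcX : ∀ j : ℕ, ∀ w, E.DX ((τ ^ j) w) = (τ ^ j) (E.DX w) := fun j w =>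
    derivation_comm_algEquiv E.DX Dx E.extX (τ ^ j) w
  have hcY : ∀ j : ℕ, ∀ w, E.DY ((τ ^ j) w) = (τ ^ j) (E.DY w) := fun j w =>
    derivation_comm_algEquiv E.DY Dy E.extY (τ ^ j) w
  have hzX : E.DX (algebraMap K E.M z) = 0 := by rw [E.extX, hDxC, map_zero]
  have hzY : E.DY (algebraMap K E.M z) = 0 := by rw [E.extY, hDyC, map_zero]
  have hfix : ∀ w : E.M, τ w = w → ∃ a : K, algebraMap K E.M a = w := by
    intro w hw
    refine (IsGalois.mem_range_algebraMap_iff_fixed w).mpr fun σ => ?_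
    have hle : Subgroup.zpowers τ ≤ MulAction.stabilizer (E.M ≃ₐ[K] E.M) w := by
      rw [Subgroup.zpowers_le]
      exact hw
    exact hle (hτgen σ)
  have hPr : ∀ D : Derivation ℚ E.M E.M, ∃ P : K,
      PrMap τ z n (psC D (fun i => algebraMap K E.M (algebraMap ℂ K (ct i))) ut vt)
        = ℓ * algebraMap K E.M P := by
    intro D
    by_cases hℓ : ℓ = 0
    · have hbot : (⊥ : IntermediateField K E.M) = ⊤ := by
        rw [← hgenℓ, hℓ, IntermediateField.adjoin_zero]
      have hsurj : ∀ w : E.M, ∃ a : K, algebraMap K E.M a = w := fun w =>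
        IntermediateField.mem_bot.mp (hbot ▸ IntermediateField.mem_top)
      have hn0 : (n : K) ≠ 0 := by exact_mod_cast hn.ne'
      have hn1 : n = 1 := by
        rw [← hrank, ← IntermediateField.finrank_top', ← hbot, IntermediateField.finrank_bot]
      have hv : vt = 0 := by
        obtain ⟨a, rfl⟩ := hsurj vt
        rw [Algebra.trace_algebraMap, hrank, hn1, one_smul] at htr
        rw [htr, map_zero]
      have hu : ∀ i, ut i = 1 := by
        intro i
        obtain ⟨a, ha⟩ := hsurj (ut i)
        have h := hnm i
        rw [← ha, Algebra.norm_algebraMap, hrank, hn1, pow_one] at h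
        rw [← ha, h, map_one]
      exact ⟨0, by simp [psC, hv, hu, PrMap]⟩
    · set g := PrMap τ z n
        (psC D (fun i => algebraMap K E.M (algebraMap ℂ K (ct i))) ut vt) with hg
      have hz0' : algebraMap K E.M z ≠ 0 := by simpa using hz0
      obtain ⟨a, ha⟩ := hfix (g / ℓ) (by
        rw [map_div₀, hτℓ, hg, apply_PrMap τ hz0 hzn hτn]
        exact mul_div_mul_left _ _ hz0')
      exact ⟨a, by rw [ha, mul_div_cancel₀ _ hℓ]⟩
  have htr' : Algebra.trace K E.M (PrMap τ z n vt) = 0 := by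
    have hsmul : PrMap τ z n vt
        = (n : K)⁻¹ • ∑ j ∈ Finset.range n, (z ^ j)⁻¹ • (τ ^ j) vt := by
      simp [PrMap, Algebra.smul_def]
    rw [hsmul, map_smul, map_sum]
    simp only [map_smul, Algebra.trace_eq_of_algEquiv, htr, smul_zero, Finset.sum_const_zero]
  have hcast : ∀ p : Fin (mt * n), algebraMap ℂ K ((n : ℂ)⁻¹
      * (ζ ^ ((finProdFinEquiv.symm p).2 : ℕ))⁻¹ * ct (finProdFinEquiv.symm p).1)
      = (n : K)⁻¹ * (z ^ ((finProdFinEquiv.symm p).2 : ℕ))⁻¹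
        * algebraMap ℂ K (ct (finProdFinEquiv.symm p).1) := fun p => by
    simp only [hz, map_mul, map_inv₀, map_pow, map_natCast]
  obtain ⟨P, hP⟩ := hPr E.DX
  obtain ⟨Q, hQ⟩ := hPr E.DY
  refine ⟨mt * n, fun p => (n : ℂ)⁻¹ * (ζ ^ ((finProdFinEquiv.symm p).2 : ℕ))⁻¹
      * ct (finProdFinEquiv.symm p).1,
    fun p => (τ ^ ((finProdFinEquiv.symm p).2 : ℕ)) (ut (finProdFinEquiv.symm p).1),
    PrMap τ z n vt, fun p => ?_, htr', fun p => ?_, ?_, ?_, P, Q, hP, hQ⟩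
  · exact (map_ne_zero (τ ^ _)).mpr (hut0 _)
  · rw [Algebra.norm_eq_of_algEquiv, hnm]
  · simp only [hcast]
    exact PrMap_psC E.DX τ hcX hzX n (fun i => algebraMap ℂ K (ct i)) ut vt
  · simp only [hcast]
    exact PrMap_psC E.DY τ hcY hzY n (fun i => algebraMap ℂ K (ct i)) ut vt
end
end

section
/- Let K = ℂ(x,y), let k ∈ K∖{0} have a factorization k = q₁^{e₁}⋯q_r^{e_r} with pairwise coprime irreducible polynomials qᵢ ∈ ℂ[x,y] and nonzero integers eᵢ, and let L = K(ℓ) where ℓⁿ = k and [L : K] = n. If no qᵢ lies in ℂ[x] (i.e. every qᵢ genuinely involves the variable y), then the subfield ℂ(x) is algebraically closed in L: every element of L that is algebraic over ℂ(x) already lies in ℂ(x). -/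
noncomputable section

/-- K = ℂ(x,y), realized as the fraction field of ℂ[x,y] = `MvPolynomial (Fin 2) ℂ`
(variable 0 is x, variable 1 is y). -/
abbrev Kxy : Type := FractionRing (MvPolynomial (Fin 2) ℂ)

/-- The image of x in K = ℂ(x,y). -/
def xK : Kxy := algebraMap (MvPolynomial (Fin 2) ℂ) Kxy (MvPolynomial.X 0)

/-- Membership in the subfield ℂ(x) ⊆ K: quotients of polynomials in x alone. -/
def MemCx (z : Kxy) : Prop :=
  ∃ p q : Polynomial ℂ, q ≠ 0 ∧
    z = Polynomial.aeval xK p / Polynomial.aeval xK q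

open Polynomial

section FracOrd

variable {R K : Type*} [CommRing R] [IsDomain R] [UniqueFactorizationMonoid R] [Field K]
  [Algebra R K] [IsFractionRing R K]

/-- The order of a nonzero fraction at an element `q` of a unique factorization domain. -/
def fracOrd (q : R) (z : K) : ℤ :=
  multiplicity q (IsFractionRing.num R z) - multiplicity q (IsFractionRing.den R z : R)

theorem multiplicity_mul_of_ne_zero {q a b : R} (hq : Prime q) (ha : a ≠ 0) (hb : b ≠ 0) :
    multiplicity q (a * b) = multiplicity q a + multiplicity q b :=
  multiplicity_mul hq (FiniteMultiplicity.of_not_isUnit hq.not_isUnit (mul_ne_zero ha hb))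

theorem fracOrd_div {q : R} (hq : Prime q) {a b : R} (ha : a ≠ 0) (hb : b ≠ 0) :
    fracOrd q (algebraMap R K a / algebraMap R K b) = multiplicity q a - multiplicity q b := by
  set z := algebraMap R K a / algebraMap R K b with hz
  have hinj := IsFractionRing.injective R K
  have ha' : algebraMap R K a ≠ 0 := (map_ne_zero_iff _ hinj).2 ha
  have hb' : algebraMap R K b ≠ 0 := (map_ne_zero_iff _ hinj).2 hb
  have hden : (IsFractionRing.den R z : R) ≠ 0 := nonZeroDivisors.coe_ne_zero _
  have hden' : algebraMap R K (IsFractionRing.den R z : R) ≠ 0 :=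
    (map_ne_zero_iff _ hinj).2 hden
  have hnum : IsFractionRing.num R z ≠ 0 := by
    rw [Ne, IsFractionRing.num_eq_zero]
    exact div_ne_zero ha' hb'
  have key : IsFractionRing.num R z * b = a * (IsFractionRing.den R z : R) := by
    apply hinj
    rw [map_mul, map_mul, ← div_eq_div_iff hden' hb', ← hz,
      ← IsFractionRing.mk'_eq_div, IsFractionRing.mk'_num_den]
  have := congrArg (multiplicity q) key
  rw [multiplicity_mul_of_ne_zero hq hnum hb, multiplicity_mul_of_ne_zero hq ha hden] at this
  unfold fracOrd
  omega

theorem fracOrd_algebraMap {q : R} (hq : Prime q) {a : R} (ha : a ≠ 0) :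
    fracOrd q (algebraMap R K a) = multiplicity q a := by
  have := fracOrd_div (K := K) hq ha one_ne_zero
  rw [map_one, div_one, multiplicity_of_one_right hq.not_isUnit] at this
  simpa using this

theorem fracOrd_mul {q : R} (hq : Prime q) {z w : K} (hz : z ≠ 0) (hw : w ≠ 0) :
    fracOrd q (z * w) = fracOrd q z + fracOrd q w := by
  obtain ⟨a, b, hb, rfl⟩ := IsFractionRing.div_surjective (A := R) z
  obtain ⟨c, d, hd, rfl⟩ := IsFractionRing.div_surjective (A := R) w
  have ha : a ≠ 0 := by rintro rfl; simp at hz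
  have hc : c ≠ 0 := by rintro rfl; simp at hw
  have hb := nonZeroDivisors.ne_zero hb
  have hd := nonZeroDivisors.ne_zero hd
  rw [div_mul_div_comm, ← map_mul, ← map_mul, fracOrd_div hq ha hb, fracOrd_div hq hc hd,
    fracOrd_div hq (mul_ne_zero ha hc) (mul_ne_zero hb hd), multiplicity_mul_of_ne_zero hq ha hc,
    multiplicity_mul_of_ne_zero hq hb hd]
  push_cast
  ring

theorem fracOrd_one {q : R} (hq : Prime q) : fracOrd q (1 : K) = 0 := by
  simpa using fracOrd_mul (K := K) hq one_ne_zero one_ne_zero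

theorem fracOrd_pow {q : R} (hq : Prime q) {z : K} (hz : z ≠ 0) (n : ℕ) :
    fracOrd q (z ^ n) = n * fracOrd q z := by
  induction n with
  | zero => simp [fracOrd_one hq]
  | succ n ih =>
    rw [pow_succ, fracOrd_mul hq (pow_ne_zero _ hz) hz, ih]
    push_cast
    ring

theorem fracOrd_zpow {q : R} (hq : Prime q) {z : K} (hz : z ≠ 0) (n : ℤ) :
    fracOrd q (z ^ n) = n * fracOrd q z := by
  obtain ⟨m, rfl | rfl⟩ := n.eq_nat_or_neg
  · simpa using fracOrd_pow hq hz m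
  · have h := fracOrd_mul hq (pow_ne_zero m hz) (inv_ne_zero (pow_ne_zero m hz))
    rw [mul_inv_cancel₀ (pow_ne_zero m hz), fracOrd_one hq, fracOrd_pow hq hz] at h
    rw [zpow_neg, zpow_natCast]
    linarith

theorem fracOrd_prod {q : R} (hq : Prime q) {ι : Type*} (s : Finset ι) {f : ι → K}
    (hf : ∀ i, f i ≠ 0) : fracOrd q (∏ i ∈ s, f i) = ∑ i ∈ s, fracOrd q (f i) := by
  classical
  induction s using Finset.induction_on with
  | empty => simp [fracOrd_one hq]
  | insert i s hi ih =>
    rw [Finset.prod_insert hi, Finset.sum_insert hi,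
      fracOrd_mul hq (hf i) (Finset.prod_ne_zero_iff.2 fun j _ => hf j), ih]

theorem fracOrd_prod_zpow {r : ℕ} {q : Fin r → R} (hq : ∀ i, Prime (q i))
    (hcop : ∀ i j, i ≠ j → ¬ Associated (q i) (q j)) (e : Fin r → ℤ) (j : Fin r) :
    fracOrd (q j) (∏ i, algebraMap R K (q i) ^ e i) = e j := by
  have hne : ∀ i, algebraMap R K (q i) ≠ 0 := fun i =>
    (map_ne_zero_iff _ (IsFractionRing.injective R K)).2 (hq i).ne_zero
  rw [fracOrd_prod (hq j) _ fun i => zpow_ne_zero _ (hne i), Finset.sum_eq_single j]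
  · rw [fracOrd_zpow (hq j) (hne j), fracOrd_algebraMap (hq j) (hq j).ne_zero]
    simp
  · intro i _ hij
    rw [fracOrd_zpow (hq j) (hne i), fracOrd_algebraMap (hq j) (hq i).ne_zero,
      multiplicity_eq_zero.2 fun h => hcop j i hij.symm ((hq j).associated_of_dvd (hq i) h)]
    simp
  · simp

end FracOrd

section Kummer

variable {E K L : Type*} [Field E] [Field K] [Field L] [Algebra E K] [Algebra K L] [Algebra E L]
  [IsScalarTower E K L]

theorem exists_isAlgebraic_terms {n : ℕ} (hn : n ≠ 0) {ζ : E} (hζ : IsPrimitiveRoot ζ n)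
    (hnE : (n : E) ≠ 0) {k : K} {l : L} (hl : l ^ n = algebraMap K L k)
    (pb : PowerBasis K L) (hgen : pb.gen = l) (hdim : pb.dim = n) {z : L} (hz : IsAlgebraic E z) :
    ∃ a : Fin n → K, z = ∑ i, algebraMap K L (a i) * l ^ (i : ℕ) ∧
      ∀ i, IsAlgebraic E (algebraMap K L (a i) * l ^ (i : ℕ)) := by
  subst hgen hdim
  have hmin : minpoly K pb.gen = X ^ pb.dim - C k := by
    have hdvd : minpoly K pb.gen ∣ X ^ pb.dim - C k := minpoly.dvd _ _ (by simp [hl])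
    refine (Polynomial.eq_of_monic_of_dvd_of_natDegree_le (minpoly.monic pb.isIntegral_gen)
      (monic_X_pow_sub_C k hn) hdvd ?_).symm
    rw [natDegree_X_pow_sub_C, pb.natDegree_minpoly]
  have hlift (j : ℕ) : aeval (algebraMap E L ζ ^ j * pb.gen) (minpoly K pb.gen) = 0 := by
    rw [hmin]
    simp only [map_sub, map_pow, aeval_X, aeval_C, mul_pow]
    rw [hl, ← pow_mul, mul_comm j, pow_mul, ← map_pow, hζ.pow_eq_one]
    simp
  let σ (j : ℕ) : L →ₐ[K] L := pb.lift _ (hlift j)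
  have hσ (j : ℕ) : σ j pb.gen = algebraMap E L ζ ^ j * pb.gen := pb.lift_gen _ _
  have hz_eq : z = ∑ i, algebraMap K L (pb.basis.repr z i) * pb.gen ^ (i : ℕ) := by
    conv_lhs => rw [← pb.basis.sum_repr z]
    simp [Algebra.smul_def]
  refine ⟨fun i => pb.basis.repr z i, hz_eq, fun i => ?_⟩
  have hζL : IsPrimitiveRoot (algebraMap E L ζ) pb.dim :=
    hζ.map_of_injective (algebraMap E L).injective
  have hζ0 : algebraMap E L ζ ≠ 0 := hζL.ne_zero hn
  have hsum : ∑ j ∈ Finset.range pb.dim, algebraMap E L ((ζ⁻¹) ^ ((i : ℕ) * j)) * σ j z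
      = algebraMap E L pb.dim * (algebraMap K L (pb.basis.repr z i) * pb.gen ^ (i : ℕ)) := by
    have h1 (j : ℕ) : σ j z = ∑ m, algebraMap K L (pb.basis.repr z m) *
        (algebraMap E L ζ ^ (j * (m : ℕ)) * pb.gen ^ (m : ℕ)) := by
      conv_lhs => rw [hz_eq]
      simp only [map_sum, map_mul, map_pow, hσ, AlgHom.commutes, mul_pow, pow_mul]
    simp_rw [h1, Finset.mul_sum]
    rw [Finset.sum_comm, Finset.sum_eq_single i]
    · rw [Finset.sum_congr rfl fun j _ => (?_ :
        _ = algebraMap K L (pb.basis.repr z i) * pb.gen ^ (i : ℕ))]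
      · simp
      · simp only [map_pow, map_inv₀, mul_comm j, inv_pow]
        field_simp
    · intro m _ hm
      have hne : (m : ℕ) ≠ i := fun h => hm (Fin.ext h)
      set ω := algebraMap E L ζ ^ (m : ℕ) * (algebraMap E L ζ ^ (i : ℕ))⁻¹ with hω
      have hω1 : ω ≠ 1 := by
        intro h
        rw [hω, mul_inv_eq_one₀ (pow_ne_zero _ hζ0)] at h
        exact hne (hζL.pow_inj m.2 i.2 h)
      have hωn : ω ^ pb.dim = 1 := by
        rw [hω, mul_pow, inv_pow, ← pow_mul, ← pow_mul, mul_comm, pow_mul', pow_mul',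
          hζL.pow_eq_one]
        simp
      have hgeom : ∑ j ∈ Finset.range pb.dim, ω ^ j = 0 := by
        have := mul_neg_geom_sum ω pb.dim
        rw [hωn, sub_self] at this
        exact (mul_eq_zero.1 this).resolve_left (sub_ne_zero.2 hω1.symm)
      rw [Finset.sum_congr rfl fun j _ => (?_ :
        _ = algebraMap K L (pb.basis.repr z m) * pb.gen ^ (m : ℕ) * ω ^ j), ← Finset.mul_sum,
        hgeom, mul_zero]
      simp only [hω, map_pow, map_inv₀, mul_pow, pow_mul, pow_right_comm _ j, inv_pow]
      ring
    · simp
  have hσalg (j : ℕ) : IsAlgebraic E (σ j z) := hz.algHom ((σ j).restrictScalars E)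
  have halg : IsAlgebraic E (algebraMap E L pb.dim *
      (algebraMap K L (pb.basis.repr z i) * pb.gen ^ (i : ℕ))) := by
    rw [← hsum]
    exact Subalgebra.sum_mem (Subalgebra.algebraicClosure E L) fun j _ =>
      (isAlgebraic_algebraMap _).mul (hσalg j)
  have := (isAlgebraic_algebraMap (A := L) ((pb.dim : E)⁻¹)).mul halg
  rwa [← mul_assoc, ← map_mul, inv_mul_cancel₀ hnE, map_one, one_mul] at this

theorem mem_range_of_isAlgebraic_of_transcendental {l : L} (hl : Transcendental K l)
    (hgen : IntermediateField.adjoin K {l} = ⊤) {z : L} (hz : IsAlgebraic K z) :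
    z ∈ (algebraMap K L).range := by
  let f := (RatFunc.algEquivOfTranscendental l hl)
  have hzmem : z ∈ IntermediateField.adjoin K {l} := hgen ▸ IntermediateField.mem_top
  have h : IsAlgebraic K (⟨z, hzmem⟩ : IntermediateField.adjoin K {l}) :=
    (isAlgebraic_algHom_iff (IntermediateField.adjoin K {l}).val Subtype.val_injective).1 hz
  have h2 : IsAlgebraic K (f.symm ⟨z, hzmem⟩) := h.algHom f.symm.toAlgHom
  by_contra hne
  refine (RatFunc.transcendental_of_ne_C _ ?_) h2
  rintro ⟨c, hc⟩
  refine hne ⟨c, ?_⟩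
  have := congrArg f hc
  rw [AlgEquiv.apply_symm_apply] at this
  have h3 : f (RatFunc.C c) = algebraMap K _ c := f.commutes c
  rw [h3] at this
  exact (congrArg Subtype.val this).symm

end Kummer

section Cx

open scoped IntermediateField.algebraAdjoinAdjoin

theorem aeval_xK (p : ℂ[X]) : aeval xK p =
    algebraMap (MvPolynomial (Fin 2) ℂ) Kxy (aeval (MvPolynomial.X 0) p) := by
  rw [xK, aeval_algebraMap_apply]

theorem aeval_xK_ne_zero {p : ℂ[X]} (hp : p ≠ 0) : aeval xK p ≠ 0 := by
  rw [aeval_xK, map_ne_zero_iff _ (IsFractionRing.injective (MvPolynomial (Fin 2) ℂ) Kxy)]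
  exact fun h => hp (by
    by_contra hp
    exact MvPolynomial.transcendental_X ℂ (0 : Fin 2) ⟨p, hp, h⟩)

theorem mem_adjoin_xK_iff {z : Kxy} :
    z ∈ IntermediateField.adjoin ℂ {xK} ↔ MemCx z := by
  rw [IntermediateField.mem_adjoin_simple_iff]
  constructor
  · rintro ⟨p, q, h⟩
    by_cases hq : q = 0
    · exact ⟨0, 1, one_ne_zero, by simp [h, hq]⟩
    · exact ⟨p, q, hq, h⟩
  · rintro ⟨p, q, -, h⟩
    exact ⟨p, q, h⟩

theorem degreeOf_one_eq_zero_iff {A : MvPolynomial (Fin 2) ℂ} :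
    MvPolynomial.degreeOf 1 A = 0 ↔ ∃ p : ℂ[X], aeval (MvPolynomial.X 0) p = A := by
  have h1 : MvPolynomial.degreeOf 1 A = 0 ↔ A ∈ MvPolynomial.supported ℂ {(0 : Fin 2)} := by
    rw [MvPolynomial.mem_supported, ← not_iff_not, ← Ne,
      ← MvPolynomial.mem_vars_iff_degreeOf_ne_zero, Set.subset_singleton_iff]
    constructor
    · exact fun h h' => one_ne_zero (h' 1 (by simpa using h))
    · intro h
      push Not at h
      obtain ⟨i, hi, hi0⟩ := h
      obtain rfl : i = 1 := by omega
      simpa using hi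
  rw [h1, MvPolynomial.supported_eq_adjoin_X, Set.image_singleton,
    Algebra.adjoin_singleton_eq_range_aeval]
  rfl

theorem degreeOf_one_eq_zero_of_dvd {A B : MvPolynomial (Fin 2) ℂ} (hB : B ≠ 0) (h : A ∣ B)
    (hB1 : MvPolynomial.degreeOf 1 B = 0) : MvPolynomial.degreeOf 1 A = 0 := by
  obtain ⟨C, rfl⟩ := h
  rw [MvPolynomial.degreeOf_mul_eq (left_ne_zero_of_mul hB) (right_ne_zero_of_mul hB)] at hB1
  omega

theorem mem_adjoin_xK_of_isAlgebraic {z : Kxy}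
    (hz : IsAlgebraic (IntermediateField.adjoin ℂ {xK}) z) :
    z ∈ IntermediateField.adjoin ℂ {xK} := by
  by_cases hz0 : z = 0
  · exact hz0 ▸ zero_mem _
  have hinj := IsFractionRing.injective (MvPolynomial (Fin 2) ℂ) Kxy
  rw [← IsFractionRing.isAlgebraic_iff (Algebra.adjoin ℂ {xK})] at hz
  obtain ⟨p, hp0, hp⟩ := hz.exists_nonzero_coeff_and_aeval_eq_zero
    (mem_nonZeroDivisors_of_ne_zero hz0)
  have hcoeff (i : ℕ) : ∃ A : MvPolynomial (Fin 2) ℂ, MvPolynomial.degreeOf 1 A = 0 ∧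
      algebraMap _ Kxy A = p.coeff i := by
    obtain ⟨c, hc⟩ := (Algebra.adjoin_singleton_eq_range_aeval ℂ xK).le (p.coeff i).2
    exact ⟨_, degreeOf_one_eq_zero_iff.2 ⟨c, rfl⟩, (aeval_xK c).symm.trans hc⟩
  have hlift : p.map (algebraMap _ Kxy) ∈
      Polynomial.lifts (algebraMap (MvPolynomial (Fin 2) ℂ) Kxy) := by
    rw [Polynomial.lifts_iff_coeff_lifts]
    intro i
    obtain ⟨A, -, hA⟩ := hcoeff i
    exact ⟨A, by rw [hA, Polynomial.coeff_map]; rfl⟩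
  obtain ⟨P, hP⟩ := (Polynomial.mem_lifts _).1 hlift
  have hPcoeff (i : ℕ) : algebraMap _ Kxy (P.coeff i) = p.coeff i := by
    rw [← Polynomial.coeff_map, hP, Polynomial.coeff_map]
    rfl
  have hPdeg (i : ℕ) : MvPolynomial.degreeOf 1 (P.coeff i) = 0 := by
    obtain ⟨A, hA1, hA⟩ := hcoeff i
    rwa [hinj ((hPcoeff i).trans hA.symm)]
  have hPz : aeval z P = 0 := by
    rw [← aeval_map_algebraMap Kxy, hP, aeval_map_algebraMap, hp]
  have hP0 : P.coeff 0 ≠ 0 := by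
    intro h
    apply hp0
    apply Subtype.ext
    rw [← hPcoeff, h, map_zero]
    rfl
  have hPne : P ≠ 0 := by rintro rfl; simp at hP0
  obtain ⟨a, ha⟩ := degreeOf_one_eq_zero_iff.1
    (degreeOf_one_eq_zero_of_dvd hP0 (num_dvd_of_is_root hPz) (hPdeg 0))
  obtain ⟨b, hb⟩ := degreeOf_one_eq_zero_iff.1
    (degreeOf_one_eq_zero_of_dvd (leadingCoeff_ne_zero.2 hPne) (den_dvd_of_is_root hPz)
      (hPdeg P.natDegree))
  rw [IntermediateField.mem_adjoin_simple_iff]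
  refine ⟨a, b, ?_⟩
  rw [aeval_xK, aeval_xK, ha, hb, ← IsFractionRing.mk'_eq_div, IsFractionRing.mk'_num_den]

theorem fracOrd_eq_zero_of_mem_adjoin_xK {q : MvPolynomial (Fin 2) ℂ} (hq : Prime q)
    (hq1 : MvPolynomial.degreeOf 1 q ≠ 0) {z : Kxy} (hz0 : z ≠ 0)
    (hz : z ∈ IntermediateField.adjoin ℂ {xK}) : fracOrd q z = 0 := by
  obtain ⟨a, b, h⟩ := (IntermediateField.mem_adjoin_simple_iff ℂ z).1 hz
  rw [aeval_xK, aeval_xK] at h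
  have ha : aeval (MvPolynomial.X 0 : MvPolynomial (Fin 2) ℂ) a ≠ 0 := fun h0 =>
    hz0 (by rw [h, h0, map_zero, zero_div])
  have hb : aeval (MvPolynomial.X 0 : MvPolynomial (Fin 2) ℂ) b ≠ 0 := fun h0 =>
    hz0 (by rw [h, h0, map_zero, div_zero])
  have key {p : ℂ[X]} (hp : aeval (MvPolynomial.X 0 : MvPolynomial (Fin 2) ℂ) p ≠ 0) :
      multiplicity q (aeval (MvPolynomial.X 0 : MvPolynomial (Fin 2) ℂ) p) = 0 :=
    multiplicity_eq_zero.2 fun hdvd =>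
      hq1 (degreeOf_one_eq_zero_of_dvd hp hdvd (degreeOf_one_eq_zero_iff.2 ⟨p, rfl⟩))
  rw [h, fracOrd_div hq ha hb, key ha, key hb, sub_self]

theorem isAlgebraic_of_root_memCx {L : Type*} [Field L] [Algebra Kxy L] {z : L} {p : Kxy[X]}
    (hp0 : p ≠ 0) (hp : ∀ i, MemCx (p.coeff i)) (hz : eval₂ (algebraMap Kxy L) z p = 0) :
    IsAlgebraic (IntermediateField.adjoin ℂ {xK}) z := by
  have hlift : p ∈ Polynomial.lifts (algebraMap (IntermediateField.adjoin ℂ {xK}) Kxy) := by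
    rw [Polynomial.lifts_iff_coeff_lifts]
    exact fun i => ⟨⟨_, mem_adjoin_xK_iff.2 (hp i)⟩, rfl⟩
  obtain ⟨P, rfl⟩ := (Polynomial.mem_lifts _).1 hlift
  refine ⟨P, by rintro rfl; simp at hp0, ?_⟩
  rwa [← aeval_map_algebraMap Kxy, aeval_def]

end Cx

section Degree

variable {K L : Type*} [Field K] [Field L] [Algebra K L]

theorem natDegree_minpoly_le_of_pow_mul_eq {d m : ℕ} (hd : d ≠ 0) [NeZero m] {ζ : K}
    (hζ : IsPrimitiveRoot ζ m) {h : K} (hh : h ≠ 0) {l : L}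
    (hl : l ^ (d * m) = algebraMap K L (h ^ m)) : (minpoly K l).natDegree ≤ d := by
  have hh' : algebraMap K L h ≠ 0 := (_root_.map_ne_zero _).2 hh
  have hu : (l ^ d / algebraMap K L h) ^ m = 1 := by
    rw [div_pow, ← pow_mul, hl, map_pow, div_self (pow_ne_zero _ hh')]
  obtain ⟨t, -, ht⟩ :=
    (hζ.map_of_injective (algebraMap K L).injective).eq_pow_of_pow_eq_one hu
  rw [eq_div_iff hh', ← map_pow, ← map_mul] at ht
  have hmon : (X ^ d - C (ζ ^ t * h)).Monic := monic_X_pow_sub_C _ hd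
  have hdvd : minpoly K l ∣ X ^ d - C (ζ ^ t * h) := minpoly.dvd _ _ (by simp [← ht])
  exact (natDegree_le_of_dvd hdvd hmon.ne_zero).trans natDegree_X_pow_sub_C.le

end Degree

theorem isPrimitiveRoot_Kxy {n : ℕ} (hn : n ≠ 0) :
    IsPrimitiveRoot (algebraMap ℂ Kxy (Complex.exp (2 * Real.pi * Complex.I / n))) n :=
  (Complex.isPrimitiveRoot_exp n hn).map_of_injective (algebraMap ℂ Kxy).injective

theorem not_isAlgebraic_mul_pow {r : ℕ} {q : Fin r → MvPolynomial (Fin 2) ℂ} {e : Fin r → ℤ}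
    (hirr : ∀ i, Irreducible (q i)) (hcop : ∀ i j, i ≠ j → ¬ Associated (q i) (q j))
    (hqy : ∀ i, MvPolynomial.degreeOf 1 (q i) ≠ 0)
    {L : Type*} [Field L] [Algebra Kxy L] {n : ℕ} {l : L}
    (hl : l ^ n = algebraMap Kxy L (∏ i, algebraMap (MvPolynomial (Fin 2) ℂ) Kxy (q i) ^ e i))
    (hdeg : (minpoly Kxy l).natDegree = n) {a : Kxy} (ha : a ≠ 0) {i : ℕ} (hi : i ≠ 0)
    (hin : i < n) :
    ¬ IsAlgebraic (IntermediateField.adjoin ℂ {xK}) (algebraMap Kxy L a * l ^ i) := by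
  intro halg
  have hq (j) : Prime (q j) := (hirr j).prime
  have hqne (j) : algebraMap (MvPolynomial (Fin 2) ℂ) Kxy (q j) ≠ 0 :=
    (map_ne_zero_iff _ (IsFractionRing.injective _ _)).2 (hq j).ne_zero
  set k := ∏ i, algebraMap (MvPolynomial (Fin 2) ℂ) Kxy (q i) ^ e i with hkdef
  have hk : k ≠ 0 := Finset.prod_ne_zero_iff.2 fun j _ => zpow_ne_zero _ (hqne j)
  have hpow : (algebraMap Kxy L a * l ^ i) ^ n = algebraMap Kxy L (a ^ n * k ^ i) := by
    rw [mul_pow, ← pow_mul, mul_comm i, pow_mul, hl, map_mul, map_pow, map_pow]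
  have hmem : a ^ n * k ^ i ∈ IntermediateField.adjoin ℂ {xK} := by
    apply mem_adjoin_xK_of_isAlgebraic
    rw [← isAlgebraic_algebraMap_iff (algebraMap Kxy L).injective, ← hpow]
    exact halg.pow n
  have hord (j) : (n : ℤ) * fracOrd (q j) a + i * e j = 0 := by
    rw [← fracOrd_prod_zpow (K := Kxy) hq hcop e j, ← hkdef, ← fracOrd_pow (hq j) ha,
      ← fracOrd_pow (hq j) hk, ← fracOrd_mul (hq j) (pow_ne_zero _ ha) (pow_ne_zero _ hk)]
    exact fracOrd_eq_zero_of_mem_adjoin_xK (hq j) (hqy j)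
      (mul_ne_zero (pow_ne_zero _ ha) (pow_ne_zero _ hk)) hmem
  obtain ⟨d, m, i', hd, hmi, rfl, rfl⟩ : ∃ d m i' : ℕ, 0 < d ∧ m.Coprime i' ∧
      n = d * m ∧ i = d * i' := by
    obtain ⟨m, i', h, h1, h2⟩ := Nat.exists_coprime n i
    exact ⟨n.gcd i, m, i', Nat.gcd_pos_of_pos_left _ (by omega), h, by linarith, by linarith⟩
  have hm : m ≠ 0 := by rintro rfl; simp at hin
  have : NeZero m := ⟨hm⟩
  have hdvd (j) : (m : ℤ) ∣ e j := by
    have h1 : (d : ℤ) * (m * fracOrd (q j) a + i' * e j) = 0 := by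
      have := hord j
      push_cast at this
      linarith
    have h2 := (mul_eq_zero.1 h1).resolve_left (by exact_mod_cast hd.ne')
    have h3 : (m : ℤ) ∣ i' * e j := ⟨-fracOrd (q j) a, by linarith⟩
    exact (Nat.isCoprime_iff_coprime.2 hmi).dvd_of_dvd_mul_left h3
  choose f hf using hdvd
  set h := ∏ j, algebraMap (MvPolynomial (Fin 2) ℂ) Kxy (q j) ^ f j with hhdef
  have hh : h ≠ 0 := Finset.prod_ne_zero_iff.2 fun j _ => zpow_ne_zero _ (hqne j)
  have hkh : k = h ^ m := by
    rw [hkdef, hhdef, ← Finset.prod_pow]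
    refine Finset.prod_congr rfl fun j _ => ?_
    rw [hf j, mul_comm, zpow_mul, zpow_natCast]
  have hle := natDegree_minpoly_le_of_pow_mul_eq hd.ne' (isPrimitiveRoot_Kxy hm) hh
    (hl.trans (congrArg _ hkh))
  rw [hdeg] at hle
  have hi' : i' ≠ 0 := by rintro rfl; simp at hi
  have h1 : m ≤ 1 := Nat.le_of_mul_le_mul_left (by linarith) hd
  have h2 : i' < m := Nat.lt_of_mul_lt_mul_left hin
  omega

/-- Lemma `algclose`. Let k = q₁^{e₁}⋯q_r^{e_r} ∈ K = ℂ(x,y) with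
pairwise non-associated irreducible qᵢ ∈ ℂ[x,y] and nonzero integer exponents, and let
L = K(ℓ) with ℓⁿ = k, [L : K] = n. If no qᵢ lies in ℂ[x], then ℂ(x) is algebraically
closed in L: every element of L algebraic over ℂ(x) lies in ℂ(x). -/
theorem cx_algebraically_closed_in_L
    (k : Kxy) (hk : k ≠ 0)
    (r : ℕ) (q : Fin r → MvPolynomial (Fin 2) ℂ) (e : Fin r → ℤ)
    (hirr : ∀ i, Irreducible (q i))
    (hcop : ∀ i j, i ≠ j → ¬ Associated (q i) (q j))
    (he : ∀ i, e i ≠ 0)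
    (hfact : k = ∏ i, (algebraMap (MvPolynomial (Fin 2) ℂ) Kxy (q i)) ^ (e i))
    (hqy : ∀ i, MvPolynomial.degreeOf 1 (q i) ≠ 0)
    (L : Type) [Field L] [Algebra Kxy L]
    (n : ℕ) (ℓ : L) (hℓ : ℓ ^ n = algebraMap Kxy L k)
    (hdeg : Module.finrank Kxy L = n)
    (hgen : IntermediateField.adjoin Kxy {ℓ} = ⊤) :
    ∀ z : L,
      (∃ p : Polynomial Kxy, p ≠ 0 ∧ (∀ i, MemCx (p.coeff i)) ∧
        Polynomial.eval₂ (algebraMap Kxy L) z p = 0) →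
      ∃ w : Kxy, MemCx w ∧ algebraMap Kxy L w = z := by
  rintro z ⟨p, hp0, hp, hpz⟩
  subst hfact
  have hz := isAlgebraic_of_root_memCx hp0 hp hpz
  suffices h : z ∈ (algebraMap Kxy L).range by
    obtain ⟨w, rfl⟩ := h
    rw [isAlgebraic_algebraMap_iff (algebraMap Kxy L).injective] at hz
    exact ⟨w, mem_adjoin_xK_iff.1 (mem_adjoin_xK_of_isAlgebraic hz), rfl⟩
  by_cases hintegral : IsIntegral Kxy ℓ
  · have hgen' : Algebra.adjoin Kxy {ℓ} = ⊤ := by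
      rw [← IntermediateField.adjoin_simple_toSubalgebra_of_isAlgebraic hintegral.isAlgebraic, hgen,
        IntermediateField.top_toSubalgebra]
    let pb := PowerBasis.ofAdjoinEqTop hintegral hgen'
    have hpbgen : pb.gen = ℓ := PowerBasis.ofAdjoinEqTop_gen hintegral hgen'
    have hpbdim : pb.dim = n := pb.finrank.symm.trans hdeg
    have hn : n ≠ 0 := hpbdim ▸ pb.dim_ne_zero
    have hmin : (minpoly Kxy ℓ).natDegree = n := by
      rw [← hpbgen, pb.natDegree_minpoly, hpbdim]
    have hζ : IsPrimitiveRoot (algebraMap ℂ (IntermediateField.adjoin ℂ {xK})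
        (Complex.exp (2 * Real.pi * Complex.I / n))) n :=
      (Complex.isPrimitiveRoot_exp n hn).map_of_injective (algebraMap ℂ _).injective
    have hnE : (n : IntermediateField.adjoin ℂ {xK}) ≠ 0 := by
      rw [← map_natCast (algebraMap ℂ (IntermediateField.adjoin ℂ {xK})) n, _root_.map_ne_zero]
      exact_mod_cast hn
    obtain ⟨a, rfl, ha⟩ := exists_isAlgebraic_terms hn hζ hnE hℓ pb hpbgen hpbdim hz
    refine sum_mem fun i _ => ?_
    by_cases hi : (i : ℕ) = 0
    · exact ⟨a i, by simp [hi]⟩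
    · have hai : a i = 0 := by
        by_contra hai
        exact not_isAlgebraic_mul_pow hirr hcop hqy hℓ hmin hai hi i.2 (ha i)
      simp [hai]
  · refine mem_range_of_isAlgebraic_of_transcendental
      (fun h => hintegral h.isIntegral) hgen (hz.tower_top _)
end
end

section
/- Let K = ℂ(x,y) and let ω be a nonzero one-form over K which is exceptional. Let L be a minimal algebraic extension of K, with [L : K] = n > 1, such that a Prelle–Singer relation for ω holds over L with data v ∈ L, u₁,…,u_m ∈ L∖{0} and constants c₁,…,c_m ∈ ℂ that are linearly independent over ℚ. If ζ is a primitive n-th root of unity, then the 2m complex numbers c₁,…,c_m, ζc₁,…,ζc_m are linearly dependent over ℚ. -/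
noncomputable section

variable (K : Type) [Field K] [CharZero K] [Algebra ℂ K]

variable {K}

theorem Derivation.map_finset_prod {R A ι : Type*} [CommRing R] [CommRing A] [Algebra R A]
    [DecidableEq ι] (D : Derivation R A A) (s : Finset ι) (f : ι → A) :
    D (∏ i ∈ s, f i) = ∑ i ∈ s, (∏ j ∈ s.erase i, f j) * D (f i) := by
  induction s using Finset.induction_on with
  | empty => simp
  | insert a s ha ih =>
    rw [Finset.prod_insert ha, D.leibniz, ih, Finset.sum_insert ha, Finset.erase_insert ha,
      smul_eq_mul, smul_eq_mul, add_comm, Finset.mul_sum]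
    congr 1
    refine Finset.sum_congr rfl fun i hi => ?_
    have hne : a ≠ i := fun h => ha (h ▸ hi)
    rw [Finset.erase_insert_of_ne hne, Finset.prod_insert (by simp [ha]), mul_assoc]

/-- Jacobi's formula for derivations. -/
theorem Derivation.map_det {R A ι : Type*} [CommRing R] [CommRing A] [Algebra R A]
    [DecidableEq ι] [Fintype ι] (D : Derivation R A A) (M : Matrix ι ι A) :
    D M.det = (M.adjugate * M.map D).trace := by
  have h : (M.adjugate * M.map D).trace = ∑ i, (M.updateCol i (fun k => D (M k i))).det := by
    rw [Matrix.trace]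
    refine Finset.sum_congr rfl fun i _ => ?_
    rw [← Matrix.cramer_apply, Matrix.cramer_eq_adjugate_mulVec]
    rfl
  rw [h]
  simp_rw [Matrix.det_apply]
  rw [Finset.sum_comm, map_sum]
  refine Finset.sum_congr rfl fun σ _ => ?_
  rw [Units.smul_def, map_zsmul, D.map_finset_prod, Finset.smul_sum]
  refine Finset.sum_congr rfl fun i _ => ?_
  rw [Units.smul_def, ← Finset.prod_erase_mul _ _ (Finset.mem_univ i)]
  congr 2
  · refine Finset.prod_congr rfl fun j hj => ?_
    rw [Matrix.updateCol_ne (Finset.ne_of_mem_erase hj)]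
  · simp

section
variable {R F L : Type*} [CommRing R] [Field F] [Field L] [Algebra R F] [Algebra R L] [Algebra F L]
  (DF : Derivation R F F) (DL : Derivation R L L)

theorem exists_leftMulMatrix_derivation {ι : Type*} [Fintype ι] [DecidableEq ι]
    (b : Module.Basis ι F L)
    (hD : ∀ a, DL (algebraMap F L a) = algebraMap F L (DF a)) :
    ∃ A : Matrix ι ι F, ∀ a : L, Algebra.leftMulMatrix b (DL a) =
      (Algebra.leftMulMatrix b a).map DF + A * Algebra.leftMulMatrix b a -
        Algebra.leftMulMatrix b a * A := by
  have hsm : ∀ (r : F) (l : L), DL (r • l) = DF r • l + r • DL l := by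
    intro r l
    rw [Algebra.smul_def, DL.leibniz, hD, smul_eq_mul, smul_eq_mul, Algebra.smul_def,
      Algebra.smul_def]
    ring
  let A : Matrix ι ι F := Matrix.of fun i j => b.repr (DL (b j)) i
  have hA : ∀ j, DL (b j) = ∑ i, A i j • b i := fun j => (b.sum_repr _).symm
  have hM : ∀ a j, a * b j = ∑ i, Algebra.leftMulMatrix b a i j • b i := by
    intro a j
    simp_rw [Algebra.leftMulMatrix_eq_repr_mul]
    exact (b.sum_repr _).symm
  refine ⟨A, fun a => ?_⟩
  have key : ∀ j, (∑ i, Algebra.leftMulMatrix b (DL a) i j • b i) =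
      ∑ i, ((Algebra.leftMulMatrix b a).map DF + A * Algebra.leftMulMatrix b a -
        Algebra.leftMulMatrix b a * A) i j • b i := by
    intro j
    have h1 : DL (a * b j) = a * DL (b j) + DL a * b j := by
      rw [DL.leibniz]; simp [mul_comm]
    have h2 : a * DL (b j) = ∑ i, (Algebra.leftMulMatrix b a * A) i j • b i := by
      rw [hA, Finset.mul_sum]
      simp_rw [mul_smul_comm, hM, Finset.smul_sum, smul_smul, Matrix.mul_apply, Finset.sum_smul]
      rw [Finset.sum_comm]
      simp_rw [mul_comm]
    have h3 : DL (a * b j) = ∑ i, ((Algebra.leftMulMatrix b a).map DF +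
        A * Algebra.leftMulMatrix b a) i j • b i := by
      rw [hM, map_sum]
      simp_rw [hsm, Finset.sum_add_distrib, Matrix.add_apply, add_smul, Finset.sum_add_distrib,
        hA, Finset.smul_sum, smul_smul, Matrix.mul_apply, Finset.sum_smul]
      rw [Finset.sum_comm (γ := ι)]
      simp_rw [mul_comm]
      rfl
    rw [← hM]
    simp_rw [Matrix.sub_apply, sub_smul, Finset.sum_sub_distrib]
    rw [← h3, ← h2, h1]
    ring
  ext i j
  have := congrArg (fun l => b.repr l i) (key j)
  simpa [Finsupp.single_apply, Finset.sum_add_distrib] using this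

variable {DF DL} [FiniteDimensional F L]

theorem trace_derivation (hD : ∀ a, DL (algebraMap F L a) = algebraMap F L (DF a)) (a : L) :
    Algebra.trace F L (DL a) = DF (Algebra.trace F L a) := by
  classical
  obtain ⟨A, hA⟩ := exists_leftMulMatrix_derivation DF DL (Module.finBasis F L) hD
  rw [Algebra.trace_eq_matrix_trace (Module.finBasis F L),
    Algebra.trace_eq_matrix_trace (Module.finBasis F L), hA, Matrix.trace_sub, Matrix.trace_add,
    Matrix.trace_mul_comm A, add_sub_cancel_right]
  simp [Matrix.trace]

theorem trace_logDeriv (hD : ∀ a, DL (algebraMap F L a) = algebraMap F L (DF a)) {u : L}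
    (hu : u ≠ 0) :
    Algebra.trace F L (DL u / u) = DF (Algebra.norm F u) / Algebra.norm F u := by
  classical
  obtain ⟨A, hA⟩ := exists_leftMulMatrix_derivation DF DL (Module.finBasis F L) hD
  have hN : Algebra.norm F u ≠ 0 := Algebra.norm_ne_zero_iff.2 hu
  rw [eq_div_iff hN]
  set M := Algebra.leftMulMatrix (Module.finBasis F L) u with hMdef
  set M' := Algebra.leftMulMatrix (Module.finBasis F L) u⁻¹ with hM'def
  have hMM : M' * M = 1 := by rw [hMdef, hM'def, ← map_mul, inv_mul_cancel₀ hu, map_one]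
  have hdet : Algebra.norm F u = M.det := Algebra.norm_eq_matrix_det _ _
  have hadj : M.adjugate = M.det • M' := by
    have h := congrArg (M' * ·) (Matrix.mul_adjugate M)
    simp only [← mul_assoc, hMM, one_mul] at h
    simpa using h
  rw [hdet, Derivation.map_det, hadj, Algebra.trace_eq_matrix_trace (Module.finBasis F L),
    div_eq_inv_mul, map_mul, ← hM'def, hA, ← hMdef, mul_sub, mul_add, ← mul_assoc M' M, hMM,
    Matrix.trace_sub, Matrix.trace_add, Matrix.trace_mul_comm M' (A * M), mul_assoc A,
    mul_eq_one_comm.1 hMM]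
  simp [mul_comm]
end

open Polynomial in
/-- The local ring at `w = 0` of the rational function field `C(w)`, inside an extension of `C`. -/
def localRingAtZero {C F : Type*} [Field C] [Field F] [Algebra C F] {w : F}
    (hw : Transcendental C w) : Subring F where
  carrier := {g | ∃ p q : C[X], q.coeff 0 ≠ 0 ∧ g = aeval w p / aeval w q}
  zero_mem' := ⟨0, 1, by simp⟩
  one_mem' := ⟨1, 1, by simp⟩
  neg_mem' := by
    rintro _ ⟨p, q, hq, rfl⟩
    exact ⟨-p, q, hq, by simp [neg_div]⟩
  mul_mem' := by
    rintro _ _ ⟨p, q, hq, rfl⟩ ⟨p', q', hq', rfl⟩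
    exact ⟨p * p', q * q', by simp [mul_coeff_zero, hq, hq'], by simp [div_mul_div_comm]⟩
  add_mem' := by
    rintro _ _ ⟨p, q, hq, rfl⟩ ⟨p', q', hq', rfl⟩
    have ne : ∀ {q : C[X]}, q.coeff 0 ≠ 0 → aeval w q ≠ 0 := fun {q} hq h =>
      hq (by rw [transcendental_iff.1 hw q h, coeff_zero])
    exact ⟨p * q' + q * p', q * q', by simp [mul_coeff_zero, hq, hq'],
      by simp [div_add_div _ _ (ne hq) (ne hq')]⟩

section
open Polynomial
variable {C F : Type*} [Field C] [Field F] [Algebra C F] {w : F} (hw : Transcendental C w)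
include hw

theorem aeval_ne_zero_of_coeff_zero_ne_zero {q : C[X]} (hq : q.coeff 0 ≠ 0) : aeval w q ≠ 0 :=
  fun h => hq (by rw [transcendental_iff.1 hw q h, coeff_zero])

theorem inv_notMem_localRingAtZero : w⁻¹ ∉ localRingAtZero hw := by
  rintro ⟨p, q, hq, h⟩
  have hw0 : w ≠ 0 := fun h => hw (h ▸ isAlgebraic_zero)
  have hq' := aeval_ne_zero_of_coeff_zero_ne_zero hw hq
  rw [eq_div_iff hq', inv_mul_eq_iff_eq_mul₀ hw0] at h
  have h0 : aeval w (q - X * p) = 0 := by simp [h]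
  rw [sub_eq_zero.1 (transcendental_iff.1 hw _ h0)] at hq
  simp at hq

theorem aeval_mem_localRingAtZero (p : C[X]) : aeval w p ∈ localRingAtZero hw :=
  ⟨p, 1, by simp⟩

theorem self_mem_localRingAtZero : w ∈ localRingAtZero hw := by
  simpa using aeval_mem_localRingAtZero hw X

theorem algebraMap_mem_localRingAtZero (c : C) : algebraMap C F c ∈ localRingAtZero hw := by
  simpa using aeval_mem_localRingAtZero hw (Polynomial.C c)

theorem derivation_mem_localRingAtZero (D : Derivation C F F) (hD : D w = 1) {g : F}
    (hg : g ∈ localRingAtZero hw) : D g ∈ localRingAtZero hw := by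
  obtain ⟨p, q, hq, rfl⟩ := hg
  have hq' := aeval_ne_zero_of_coeff_zero_ne_zero hw hq
  refine ⟨derivative p * q - p * derivative q, q ^ 2, by simp [pow_two, mul_coeff_zero, hq], ?_⟩
  have hp : D (aeval w p) = aeval w (derivative p) := by simp [D.map_aeval, hD]
  have hqd : D (aeval w q) = aeval w (derivative q) := by simp [D.map_aeval, hD]
  rw [D.leibniz_div, hp, hqd]
  simp only [smul_eq_mul, map_sub, map_mul, map_pow]
  field_simp

theorem exists_eq_zpow_mul_unit (hgen : ∀ g : F, ∃ p q : C[X], g = aeval w p / aeval w q)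
    {g : F} (hg : g ≠ 0) : ∃ (k : ℤ) (s : F), s ≠ 0 ∧ s ∈ localRingAtZero hw ∧
      s⁻¹ ∈ localRingAtZero hw ∧ g = w ^ k * s := by
  have hw0 : w ≠ 0 := fun h => hw (h ▸ isAlgebraic_zero)
  have fac : ∀ p : C[X], p ≠ 0 → ∃ (n : ℕ) (q : C[X]), q.coeff 0 ≠ 0 ∧ p = X ^ n * q := by
    intro p hp
    obtain ⟨q, hq, hd⟩ := exists_eq_pow_rootMultiplicity_mul_and_not_dvd p hp 0
    rw [Polynomial.C_0, sub_zero] at hq hd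
    exact ⟨_, q, by rwa [X_dvd_iff] at hd, hq⟩
  obtain ⟨p, q, rfl⟩ := hgen g
  obtain ⟨n, p', hp', rfl⟩ := fac p (by rintro rfl; simp at hg)
  obtain ⟨m, q', hq', rfl⟩ := fac q (by rintro rfl; simp at hg)
  have h1 := aeval_ne_zero_of_coeff_zero_ne_zero hw hp'
  have h2 := aeval_ne_zero_of_coeff_zero_ne_zero hw hq'
  refine ⟨n - m, aeval w p' / aeval w q', div_ne_zero h1 h2, ⟨p', q', hq', rfl⟩,
    ⟨q', p', hp', by rw [inv_div]⟩, ?_⟩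
  rw [zpow_sub₀ hw0]
  simp [div_mul_div_comm]

variable [CharZero F]

theorem eq_zero_of_div_add_add_derivation_eq_zero
    (hgen : ∀ g : F, ∃ p q : C[X], g = aeval w p / aeval w q)
    (D : Derivation C F F) (hD : D w = 1) (a : C) {o h : F} (ho : o ∈ localRingAtZero hw)
    (hsum : algebraMap C F a / w + o + D h = 0) : a = 0 := by
  have hw0 : w ≠ 0 := fun h => hw (h ▸ isAlgebraic_zero)
  have hwO := self_mem_localRingAtZero hw
  have hDO := fun {g} => derivation_mem_localRingAtZero hw D hD (g := g)
  have hinv := inv_notMem_localRingAtZero hw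
  by_contra ha
  have ha' : algebraMap C F a ≠ 0 := by simpa using ha
  have key : D h ∉ localRingAtZero hw := fun hh => hinv (by
    have h1 : w⁻¹ = algebraMap C F a⁻¹ * (-(o + D h)) := by
      have : o + D h = -(algebraMap C F a / w) := by linear_combination hsum
      rw [this, map_inv₀]
      field_simp
    rw [h1]
    exact mul_mem (algebraMap_mem_localRingAtZero hw _) (neg_mem (add_mem ho hh)))
  have hh : h ≠ 0 := by
    rintro rfl
    exact key (by simp)
  obtain ⟨k, s, hs0, hs, hs', rfl⟩ := exists_eq_zpow_mul_unit hw hgen hh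
  obtain ⟨n, rfl | rfl⟩ := k.eq_nat_or_neg
  · exact key (hDO (mul_mem (by simpa using pow_mem hwO n) hs))
  · rcases n with _ | n
    · exact key (hDO (by simpa using hs))
    have hDh : D (w ^ (-((n + 1 : ℕ) : ℤ)) * s) * w ^ (n + 1) = -(n + 1 : F) * w⁻¹ * s + D s := by
      rw [zpow_neg, zpow_natCast, D.leibniz, D.leibniz_inv, D.leibniz_pow, hD]
      simp only [smul_eq_mul, nsmul_eq_mul, Nat.add_sub_cancel]
      push_cast
      field_simp
      ring
    have hn : (n + 1 : F) ≠ 0 := Nat.cast_add_one_ne_zero n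
    have h1 : w⁻¹ = algebraMap C F ((n + 1 : C)⁻¹) * s⁻¹ *
        (algebraMap C F a * w ^ n + w ^ (n + 1) * o + D s) := by
      have h2 : algebraMap C F a * w ^ n + w ^ (n + 1) * o + D s = (n + 1 : F) * w⁻¹ * s := by
        have h3 := congrArg (· * w ^ (n + 1)) hsum
        simp only [add_mul, hDh, zero_mul] at h3
        have h4 : algebraMap C F a / w * w ^ (n + 1) = algebraMap C F a * w ^ n := by
          field_simp
          ring
        rw [h4] at h3
        linear_combination h3
      rw [h2, map_inv₀, map_add, map_natCast, map_one]
      field_simp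
    refine hinv (h1 ▸ mul_mem (mul_mem (algebraMap_mem_localRingAtZero hw _) hs')
      (add_mem (add_mem (mul_mem (algebraMap_mem_localRingAtZero hw _) (pow_mem hwO n))
        (mul_mem (pow_mem hwO _) ho)) (hDO hs)))

theorem sum_mul_order_eq_zero {ι : Type*} [Fintype ι] [DecidableEq ι]
    (hgen : ∀ g : F, ∃ p q : C[X], g = aeval w p / aeval w q)
    (D : Derivation C F F) (hD : D w = 1) (a : ι → C) (u : ι → F) (h : F) (hu : ∀ i, u i ≠ 0)
    (hsum : ∑ i, algebraMap C F (a i) * (D (u i) / u i) + D h = 0)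
    (i₀ : ι) (n : ℕ) (hi₀ : u i₀ = w ^ n) :
    ∃ k : ι → ℤ, k i₀ = n ∧ ∑ i, (k i : C) * a i = 0 := by
  have hw0 : w ≠ 0 := fun h => hw (h ▸ isAlgebraic_zero)
  have hex : ∀ i, ∃ (k : ℤ) (s : F), (i = i₀ → k = n) ∧ s ≠ 0 ∧ s ∈ localRingAtZero hw ∧
      s⁻¹ ∈ localRingAtZero hw ∧ u i = w ^ k * s := by
    intro i
    by_cases hi : i = i₀
    · exact ⟨n, 1, fun _ => rfl, one_ne_zero, one_mem _, by simp, by simp [hi, hi₀]⟩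
    · obtain ⟨k, s, H⟩ := exists_eq_zpow_mul_unit hw hgen (hu i)
      exact ⟨k, s, fun h => (hi h).elim, H⟩
  choose k s hk hs0 hs hs' hus using hex
  refine ⟨k, hk i₀ rfl, ?_⟩
  have hlog : ∀ i, D (u i) / u i = (k i : F) / w + D (s i) * (s i)⁻¹ := by
    intro i
    have hwk : w ^ k i ≠ 0 := zpow_ne_zero _ hw0
    have : D (w ^ k i) = k i * w ^ (k i - 1) := by
      rw [D.leibniz_zpow, hD]; simp
    rw [hus, D.leibniz, this, zpow_sub_one₀ hw0]
    have := hs0 i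
    simp only [smul_eq_mul]
    field_simp
    ring
  refine eq_zero_of_div_add_add_derivation_eq_zero hw hgen D hD _
    (o := ∑ i, algebraMap C F (a i) * (D (s i) * (s i)⁻¹)) (h := h) ?_ ?_
  · exact sum_mem fun i _ => mul_mem (algebraMap_mem_localRingAtZero hw _)
      (mul_mem (derivation_mem_localRingAtZero hw D hD (hs i)) (hs' i))
  · rw [← hsum, map_sum, Finset.sum_div, ← Finset.sum_add_distrib]
    congr 1
    refine Finset.sum_congr rfl fun i _ => ?_
    rw [hlog, map_mul, map_intCast]
    ring
end

section
open IntermediateField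

/-- The restriction of a derivation to an intermediate field which it preserves. -/
def Derivation.restrictIntermediateField {R k L : Type*} [CommRing R] [Field k] [Field L]
    [Algebra R k] [Algebra R L] [Algebra k L] [IsScalarTower R k L] (D : Derivation R L L)
    (F : IntermediateField k L) (hF : ∀ a ∈ F, D a ∈ F) : Derivation R F F :=
  Derivation.mk'
    { toFun := fun a => ⟨D a, hF a a.2⟩
      map_add' := fun a b => Subtype.ext (by simp)
      map_smul' := fun r a => Subtype.ext (D.map_smul r (a : L)) }
    fun a b => Subtype.ext (by simp)

/-- A derivation of a field which kills the image of `C`, as a `C`-linear derivation. -/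
def Derivation.extendConstants {R L : Type*} (C : Type*) [CommRing R] [Field L] [Field C]
    [Algebra R L] [Algebra C L] (D : Derivation R L L)
    (h : ∀ c : C, D (algebraMap C L c) = 0) : Derivation C L L :=
  Derivation.mk'
    { toFun := D
      map_add' := fun a b => map_add D a b
      map_smul' := fun c a => by simp [Algebra.smul_def, h] }
    fun a b => D.leibniz a b

theorem derivation_eq_zero_of_isAlgebraic {C L : Type*} [Field C] [Field L] [CharZero C]
    [Algebra C L] (D : Derivation C L L) {a : L} (ha : IsAlgebraic C a) : D a = 0 := by
  have h := D.map_aeval (minpoly C a) a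
  rw [minpoly.aeval, map_zero, smul_eq_mul, eq_comm, mul_eq_zero] at h
  exact h.resolve_left <| (minpoly.irreducible ha.isIntegral).separable.aeval_derivative_ne_zero
    (minpoly.aeval C a)

/-- The field of constants of a derivation. -/
def Derivation.constants {k L : Type*} [Field k] [Field L] [Algebra k L] (D : Derivation k L L) :
    IntermediateField k L where
  carrier := {a | D a = 0}
  mul_mem' := by
    intro a b ha hb
    simp_all
  add_mem' := by
    intro a b ha hb
    simp_all
  algebraMap_mem' := fun c => D.map_algebraMap c
  inv_mem' := by
    intro a (ha : D a = 0)
    change D a⁻¹ = 0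
    rw [D.leibniz_inv, ha, smul_zero]

theorem finiteDimensional_adjoin_of_trdeg_le_one {C L : Type} [Field C] [Field L]
    [Algebra C L] [Algebra.EssFiniteType C L] (htr : Algebra.trdeg C L ≤ 1) {w : L}
    (hw : Transcendental C w) : FiniteDimensional C⟮w⟯ L := by
  have hind : AlgebraicIndependent C (fun _ : Unit => w) :=
    (algebraicIndependent_unique_type_iff).2 hw
  have hb := hind.isTranscendenceBasis_of_trdeg_le_of_finite (by simpa using htr)
  have := hb.isAlgebraic_field
  rw [Set.range_const] at this
  have : Algebra.EssFiniteType C⟮w⟯ L := Algebra.EssFiniteType.of_comp C _ L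
  exact Algebra.finite_of_essFiniteType_of_isAlgebraic

theorem derivation_mem_adjoin_simple {C L : Type*} [Field C] [Field L]
    [Algebra C L] (D : Derivation C L L) {w : L} (hw : D w ∈ C⟮w⟯) {a : L} (ha : a ∈ C⟮w⟯) :
    D a ∈ C⟮w⟯ := by
  have hmem : ∀ p : Polynomial C, Polynomial.aeval w p ∈ C⟮w⟯ := fun p =>
    (mem_adjoin_simple_iff _ _).2 ⟨p, 1, by simp⟩
  obtain ⟨p, q, rfl⟩ := (mem_adjoin_simple_iff _ _).1 ha
  rw [D.leibniz_div, D.map_aeval, D.map_aeval]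
  simp only [smul_eq_mul]
  exact mul_mem (pow_mem (inv_mem (hmem q)) 2) (sub_mem (mul_mem (hmem q) (mul_mem (hmem _) hw))
    (mul_mem (hmem p) (mul_mem (hmem _) hw)))

/-- In one variable, if `∑ aᵢ duᵢ/uᵢ` is exact and the constants `aᵢ` are linearly independent over
the rational numbers, then all the `uᵢ` are constant. -/
theorem derivation_eq_zero_of_sum_logDeriv {C L : Type} [Field C] [Field L] [CharZero L]
    [Algebra C L] [Algebra.EssFiniteType C L] (htr : Algebra.trdeg C L ≤ 1)
    (D : Derivation C L L) {ι : Type*} [Fintype ι] (a : ι → C)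
    (hind : ∀ k : ι → ℤ, ∑ i, (k i : C) * a i = 0 → k = 0) (u : ι → L) (hu : ∀ i, u i ≠ 0) (h : L)
    (hsum : ∑ i, algebraMap C L (a i) * (D (u i) / u i) + D h = 0) (i : ι) : D (u i) = 0 := by
  classical
  have : CharZero C := (algebraMap C L).charZero
  by_contra hDw
  have hw : Transcendental C (u i) := fun halg => hDw (derivation_eq_zero_of_isAlgebraic D halg)
  have hfin := finiteDimensional_adjoin_of_trdeg_le_one htr hw
  let d : Derivation C L L := (D (u i))⁻¹ • D
  have hd : ∀ z, d z = (D (u i))⁻¹ * D z := fun z => rfl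
  have hdw : d (u i) = 1 := inv_mul_cancel₀ hDw
  have hF : ∀ z ∈ C⟮u i⟯, d z ∈ C⟮u i⟯ := fun z hz =>
    derivation_mem_adjoin_simple d (hdw ▸ one_mem _) hz
  let dF := d.restrictIntermediateField C⟮u i⟯ hF
  have hcomp : ∀ z, d (algebraMap C⟮u i⟯ L z) = algebraMap C⟮u i⟯ L (dF z) := fun z => rfl
  let w : C⟮u i⟯ := AdjoinSimple.gen C (u i)
  have hgen : ∀ g : C⟮u i⟯, ∃ p q : Polynomial C,
      g = Polynomial.aeval w p / Polynomial.aeval w q := by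
    intro g
    obtain ⟨p, q, hpq⟩ := (mem_adjoin_simple_iff _ _).1 g.2
    refine ⟨p, q, Subtype.ext ?_⟩
    rw [hpq]
    simp [w]
  have hsumd : ∑ j, algebraMap C L (a j) * (d (u j) / u j) + d h = 0 := by
    have h1 := congrArg ((D (u i))⁻¹ * ·) hsum
    simp only [mul_add, Finset.mul_sum, mul_zero] at h1
    rw [← h1]
    simp only [hd]
    congr 1
    refine Finset.sum_congr rfl fun j _ => ?_
    ring
  have htrace := congrArg (Algebra.trace C⟮u i⟯ L) hsumd
  simp only [← Algebra.smul_def] at htrace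
  simp only [map_add, map_sum, map_zero, ← algebraMap_smul C⟮u i⟯ (_ : C) (_ : L), map_smul] at htrace
  simp only [trace_logDeriv hcomp (hu _), trace_derivation hcomp, smul_eq_mul] at htrace
  have hwtr : Transcendental C w := by
    rw [← transcendental_algebraMap_iff (algebraMap C⟮u i⟯ L).injective]
    simpa [w] using hw
  obtain ⟨k, hk, hk0⟩ := sum_mul_order_eq_zero hwtr hgen dF (Subtype.ext hdw) a
    (fun j => Algebra.norm C⟮u i⟯ (u j)) _ (fun j => Algebra.norm_ne_zero_iff.2 (hu j)) htrace i
    (Module.finrank C⟮u i⟯ L) (Algebra.norm_algebraMap (S := L) w)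
  rw [hind k hk0] at hk
  have : 0 < Module.finrank C⟮u i⟯ L := Module.finrank_pos
  simp at hk
  omega
end

section
open IntermediateField Polynomial

variable {k K L : Type} [Field k] [Field K] [Field L] [CharZero k] [Algebra k K] [Algebra k L]
  [Algebra K L] [IsScalarTower k K L]

theorem one_le_trdeg_of_derivation_ne_zero (D : Derivation k L L) {x : L} (hx : D x ≠ 0) :
    1 ≤ Algebra.trdeg k L := by
  rw [Cardinal.one_le_iff_ne_zero, ne_eq, trdeg_eq_zero_iff]
  intro h
  exact hx (derivation_eq_zero_of_isAlgebraic D (h.isAlgebraic x))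

theorem one_le_trdeg_constants (D₁ D₂ : Derivation k L L) {y : L} (hy₁ : D₁ y = 0)
    (hy₂ : D₂ y ≠ 0) : 1 ≤ Algebra.trdeg k D₁.constants := by
  rw [Cardinal.one_le_iff_ne_zero, ne_eq, trdeg_eq_zero_iff]
  intro h
  have h1 : IsAlgebraic k (⟨y, hy₁⟩ : D₁.constants) := h.isAlgebraic _
  exact hy₂ (derivation_eq_zero_of_isAlgebraic D₂ (h1.algebraMap (A := L)))

theorem trdeg_over_constants_le_one (htr : Algebra.trdeg k L ≤ 2) (D₁ D₂ : Derivation k L L)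
    {y : L} (hy₁ : D₁ y = 0) (hy₂ : D₂ y ≠ 0) : Algebra.trdeg D₁.constants L ≤ 1 := by
  have h1 := one_le_trdeg_constants D₁ D₂ hy₁ hy₂
  have h2 := trdeg_add_eq k D₁.constants (A := L)
  by_contra hlt
  have h3 : 2 ≤ Algebra.trdeg D₁.constants L := by
    have := Cardinal.natCast_add_one_le_iff (n := 1).2 (by simpa using hlt)
    rwa [Nat.cast_one, one_add_one_eq_two] at this
  have h4 : (1 + 2 : Cardinal) ≤ 2 := (add_le_add h1 h3).trans (h2.le.trans htr)
  norm_num at h4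

theorem two_le_trdeg (D₁ D₂ : Derivation k L L) {x y : L} (hx₁ : D₁ x ≠ 0) (hy₁ : D₁ y = 0)
    (hy₂ : D₂ y ≠ 0) : 2 ≤ Algebra.trdeg k L := by
  have : CharZero D₁.constants :=
    charZero_of_injective_algebraMap (algebraMap k D₁.constants).injective
  rw [← trdeg_add_eq k D₁.constants (A := L), ← one_add_one_eq_two]
  exact add_le_add (one_le_trdeg_constants D₁ D₂ hy₁ hy₂)
    (one_le_trdeg_of_derivation_ne_zero (D₁.extendConstants D₁.constants fun c => c.2) hx₁)

theorem mem_range_of_derivations_eq_zero [IsAlgClosed k] (htr : Algebra.trdeg k L ≤ 2)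
    (D₁ D₂ : Derivation k L L) {x y : L} (hx₁ : D₁ x ≠ 0) (hy₁ : D₁ y = 0)
    (hy₂ : D₂ y ≠ 0) {g : L} (h₁ : D₁ g = 0) (h₂ : D₂ g = 0) : ∃ z : k, algebraMap k L z = g := by
  let C : IntermediateField k L := D₁.constants ⊓ D₂.constants
  have : CharZero C := charZero_of_injective_algebraMap (algebraMap k C).injective
  have h2 : 2 ≤ Algebra.trdeg C L :=
    two_le_trdeg (D₁.extendConstants C fun c => c.2.1) (D₂.extendConstants C fun c => c.2.2)
      hx₁ hy₁ hy₂
  have : FaithfulSMul k C :=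
    (faithfulSMul_iff_algebraMap_injective k C).2 (algebraMap k C).injective
  have h3 := trdeg_add_eq k C (A := L)
  have h0 : Algebra.trdeg k C = 0 := by
    by_contra hne
    have h4 : (1 + 2 : Cardinal) ≤ 2 :=
      (add_le_add (Cardinal.one_le_iff_ne_zero.2 hne) h2).trans (h3.le.trans htr)
    norm_num at h4
  rw [trdeg_eq_zero_iff] at h0
  obtain ⟨z, hz⟩ := (IsAlgClosed.algebraMap_bijective_of_isIntegral (k := k) (K := C)).2 ⟨g, h₁, h₂⟩
  exact ⟨z, congrArg Subtype.val hz⟩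

variable {DK : Derivation k K K} {DL : Derivation k L L}

omit [CharZero k] [IsScalarTower k K L] in
theorem derivation_coeff_minpoly [FiniteDimensional K L]
    (hD : ∀ a, DL (algebraMap K L a) = algebraMap K L (DK a)) {f : L} {μ : K}
    (hf : DL f = μ • f) (j : ℕ) :
    DK ((minpoly K f).coeff j) = ((minpoly K f).natDegree - j : K) * μ * (minpoly K f).coeff j := by
  set p := minpoly K f with hp
  set d := p.natDegree with hd
  have hmonic : p.Monic := minpoly.monic (Algebra.IsIntegral.isIntegral f)
  let q : K[X] := ∑ i ∈ Finset.range (d + 1),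
    Polynomial.C (DK (p.coeff i) - (d - i : K) * μ * p.coeff i) * X ^ i
  have hqc : ∀ i, q.coeff i =
      if i < d + 1 then DK (p.coeff i) - (d - i : K) * μ * p.coeff i else 0 := by
    intro i
    simp only [q, finsetSum_coeff, coeff_C_mul_X_pow]
    simp
  have hfp : ∀ i : ℕ, DL (f ^ i) = ((i : K) * μ) • f ^ i := by
    intro i
    rcases i with _ | i
    · simp
    · rw [DL.leibniz_pow, hf]
      simp only [smul_eq_mul, nsmul_eq_mul]
      simp only [Algebra.smul_def, map_mul, Nat.cast_add, Nat.cast_one, map_natCast, map_add,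
        map_one, Nat.add_sub_cancel]
      ring
  have hterm : ∀ i : ℕ,
      DL (p.coeff i • f ^ i) = (DK (p.coeff i) + (i : K) * μ * p.coeff i) • f ^ i := by
    intro i
    rw [Algebra.smul_def, DL.leibniz, hfp, hD]
    simp only [smul_eq_mul]
    simp only [Algebra.smul_def, map_mul, map_natCast, map_add]
    ring
  have hsum : ∑ i ∈ Finset.range (d + 1), p.coeff i • f ^ i = 0 := by
    rw [← aeval_eq_sum_range, hp, minpoly.aeval]
  have hq0 : aeval f q = 0 := by
    have h1 := congrArg DL hsum
    rw [map_sum, map_zero] at h1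
    have h2 : aeval f q = ∑ i ∈ Finset.range (d + 1), DL (p.coeff i • f ^ i) -
        (d * μ : K) • ∑ i ∈ Finset.range (d + 1), p.coeff i • f ^ i := by
      simp only [q, map_sum, map_mul, aeval_C, aeval_X, map_pow, Finset.smul_sum,
        ← Finset.sum_sub_distrib]
      refine Finset.sum_congr rfl fun i _ => ?_
      rw [hterm]
      simp only [Algebra.smul_def, map_mul, map_natCast, map_add, map_sub]
      ring
    rw [h2, h1, hsum, smul_zero, sub_zero]
  have hqz : q = 0 := by
    by_contra hne
    have hle := natDegree_le_of_dvd (minpoly.dvd K f hq0) hne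
    have hlt : q.natDegree < d := by
      rw [natDegree_lt_iff_degree_lt hne, degree_lt_iff_coeff_zero]
      intro i hi
      rw [hqc]
      split_ifs with h
      · obtain rfl : i = d := by omega
        rw [hd, hmonic.coeff_natDegree]
        simp
      · rfl
    exact absurd hle (not_le.2 hlt)
  have := hqc j
  rw [hqz, coeff_zero] at this
  split_ifs at this with h
  · exact sub_eq_zero.1 this.symm
  · rw [coeff_eq_zero_of_natDegree_lt (by omega)]
    simp

variable [CharZero K] [CharZero L] [FiniteDimensional K L]

omit [CharZero k] [IsScalarTower k K L] [CharZero L] in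
theorem derivation_eq_zero_of_coeff_minpoly
    (hD : ∀ a, DL (algebraMap K L a) = algebraMap K L (DK a)) {g : L}
    (hg : ∀ j, DK ((minpoly K g).coeff j) = 0) : DL g = 0 := by
  let : Differential K := ⟨DK.restrictScalars ℤ⟩
  let : Differential L := ⟨DL.restrictScalars ℤ⟩
  have : DifferentialAlgebra K L := ⟨fun a => hD a⟩
  have h := Differential.deriv_aeval_eq (A := K) g (minpoly K g)
  have h0 : Differential.mapCoeffs (minpoly K g) = 0 := by
    ext j
    rw [Differential.coeff_mapCoeffs]
    exact hg j
  rw [h0, minpoly.aeval, map_zero, map_zero, zero_add, eq_comm, mul_eq_zero] at h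
  exact h.resolve_left <| (minpoly.irreducible
    (Algebra.IsIntegral.isIntegral g)).separable.aeval_derivative_ne_zero (minpoly.aeval K g)

omit [CharZero k] [IsScalarTower k K L] [CharZero L] in
theorem algHom_derivation (hD : ∀ a, DL (algebraMap K L a) = algebraMap K L (DK a))
    (σ : L →ₐ[K] L) (a : L) : σ (DL a) = DL (σ a) := by
  let : Differential K := ⟨DK.restrictScalars ℤ⟩
  let : Differential L := ⟨DL.restrictScalars ℤ⟩
  have : DifferentialAlgebra K L := ⟨fun a => hD a⟩
  exact Differential.algHom_deriv' σ σ.injective a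

omit [CharZero k] [IsScalarTower k K L] [CharZero L] in
theorem derivation_mem_intermediateField
    (hD : ∀ a, DL (algebraMap K L a) = algebraMap K L (DK a)) (F : IntermediateField K L) {a : L}
    (ha : a ∈ F) : DL a ∈ F := by
  let : Differential K := ⟨DK.restrictScalars ℤ⟩
  let : Differential L := ⟨DL.restrictScalars ℤ⟩
  have : DifferentialAlgebra K L := ⟨fun a => hD a⟩
  have h := deriv_algebraMap (A := F) (B := L) ⟨a, ha⟩
  have h' : DL a = _ := h
  rw [h']
  exact Subtype.prop _

omit [CharZero k] [IsScalarTower k K L] [CharZero L] in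
theorem derivation_comm {DK₁ DK₂ : Derivation k K K} {D₁ D₂ : Derivation k L L}
    (h₁ : ∀ a, D₁ (algebraMap K L a) = algebraMap K L (DK₁ a))
    (h₂ : ∀ a, D₂ (algebraMap K L a) = algebraMap K L (DK₂ a))
    (hcomm : ∀ a, DK₁ (DK₂ a) = DK₂ (DK₁ a)) (a : L) : D₁ (D₂ a) = D₂ (D₁ a) := by
  have := derivation_eq_zero_of_isAlgebraic ((⁅D₁, D₂⁆ : Derivation k L L).extendConstants K
    fun c => by simp [Derivation.commutator_apply, h₁, h₂, hcomm])
    (Algebra.IsAlgebraic.isAlgebraic a)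
  have h : ⁅D₁, D₂⁆ a = 0 := this
  rwa [Derivation.commutator_apply, sub_eq_zero] at h

/-- The coefficient along `D` of the one-form `∑ cᵢ duᵢ/uᵢ + dv`. -/
def logForm (D : Derivation k L L) {m : ℕ} (c : Fin m → k) (u : Fin m → L) (v : L) : L :=
  ∑ i, algebraMap k L (c i) * (D (u i) / u i) + D v

omit [CharZero k] in
theorem derivation_logForm_comm {D₁ D₂ : Derivation k L L} (hcomm : ∀ a, D₁ (D₂ a) = D₂ (D₁ a))
    {m : ℕ} (c : Fin m → k) (u : Fin m → L) (v : L) :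
    D₁ (logForm D₂ c u v) = D₂ (logForm D₁ c u v) := by
  simp only [logForm, map_add, map_sum, hcomm v]
  congr 1
  refine Finset.sum_congr rfl fun i _ => ?_
  simp only [Derivation.leibniz, Derivation.leibniz_div, Derivation.map_algebraMap, smul_eq_mul,
    hcomm (u i)]
  ring

omit [CharZero k] [CharZero K] [CharZero L] in
theorem trace_logForm (F : IntermediateField K L) (hF : ∀ a ∈ F, DL a ∈ F)
    {m : ℕ} (c : Fin m → k) {u : Fin m → L} (hu : ∀ i, u i ≠ 0) (v : L) :
    (Algebra.trace F L (logForm DL c u v) : L) =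
      logForm DL c (fun i => (Algebra.norm F (u i) : L)) (Algebra.trace F L v : L) := by
  let dF := DL.restrictIntermediateField F hF
  have : IsScalarTower k F L := .of_algebraMap_eq fun a => rfl
  have hcomp : ∀ z, DL (algebraMap F L z) = algebraMap F L (dF z) := fun z => rfl
  have h : Algebra.trace F L (logForm DL c u v) =
      logForm dF c (fun i => Algebra.norm F (u i)) (Algebra.trace F L v) := by
    simp only [logForm, map_add, map_sum, ← Algebra.smul_def, ← algebraMap_smul F (_ : k) (_ : L),
      map_smul, trace_logDeriv hcomp (hu _), trace_derivation hcomp, smul_eq_mul]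
  rw [h]
  simp only [logForm]
  push_cast
  rfl
end

section
open IntermediateField Polynomial

variable {k K L : Type} [Field k] [Field K] [Field L] [Algebra k K] [Algebra k L]
  [Algebra K L] [IsScalarTower k K L]

theorem trdeg_le_two_of_adjoin_eq_top {x y : K} (hgen : IntermediateField.adjoin k {x, y} = ⊤)
    [Algebra.IsAlgebraic K L] : Algebra.trdeg k L ≤ 2 := by
  have h1 : Algebra.IsAlgebraic (Algebra.adjoin k ({x, y} : Set K)) K := by
    rw [← isAlgebraic_adjoin_iff_top, hgen]
    exact ⟨fun a => isAlgebraic_algebraMap (⟨a, trivial⟩ : (⊤ : IntermediateField k K))⟩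
  have h2 := Algebra.IsAlgebraic.trdeg_le_cardinalMk (R := k) (A := K) ({x, y} : Set K)
  rw [← trdeg_add_eq k K (A := L), trdeg_eq_zero (R := K) (A := L), add_zero]
  refine h2.trans ?_
  refine (Cardinal.mk_insert_le).trans ?_
  rw [Cardinal.mk_singleton, one_add_one_eq_two]

theorem essFiniteType_of_adjoin_eq_top {s : Set K} (hs : s.Finite)
    (hgen : IntermediateField.adjoin k s = ⊤) [FiniteDimensional K L] :
    Algebra.EssFiniteType k L := by
  have := hs.to_subtype
  have : Algebra.EssFiniteType k K := IntermediateField.fg_top_iff.1 (hgen ▸ fg_adjoin_of_finite hs)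
  exact .comp k K L

variable {DK₁ DK₂ : Derivation k K K} {D₁ D₂ : Derivation k L L} {P Q : K}
  [CharZero K] [FiniteDimensional K L]

theorem derivations_eq_zero_of_first_integral
    (h₁ : ∀ a, D₁ (algebraMap K L a) = algebraMap K L (DK₁ a))
    (h₂ : ∀ a, D₂ (algebraMap K L a) = algebraMap K L (DK₂ a))
    (hrat : ∀ a : K, DK₁ a * Q - DK₂ a * P = 0 → DK₁ a = 0 ∧ DK₂ a = 0) {g : L}
    (hg : D₁ g * algebraMap K L Q - D₂ g * algebraMap K L P = 0) : D₁ g = 0 ∧ D₂ g = 0 := by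
  have hD : ∀ a, (algebraMap K L Q • D₁ - algebraMap K L P • D₂) (algebraMap K L a) =
      algebraMap K L ((Q • DK₁ - P • DK₂) a) := fun a => by simp [h₁, h₂, Algebra.smul_def]
  have hcoeff : ∀ j, DK₁ ((minpoly K g).coeff j) = 0 ∧ DK₂ ((minpoly K g).coeff j) = 0 := by
    intro j
    have h := derivation_coeff_minpoly hD (f := g) (μ := 0)
      (by simp [Algebra.smul_def]; linear_combination hg) j
    refine hrat _ ?_
    simp at h
    linear_combination h
  exact ⟨derivation_eq_zero_of_coeff_minpoly h₁ fun j => (hcoeff j).1,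
    derivation_eq_zero_of_coeff_minpoly h₂ fun j => (hcoeff j).2⟩

theorem minpoly_eq_X_pow_sub_C [CharZero k] [CharZero L] [IsAlgClosed k]
    (htr : Algebra.trdeg k L ≤ 2) {x y : L} (hx₁ : D₁ x ≠ 0) (hy₁ : D₁ y = 0) (hy₂ : D₂ y ≠ 0)
    (h₁ : ∀ a, D₁ (algebraMap K L a) = algebraMap K L (DK₁ a))
    (h₂ : ∀ a, D₂ (algebraMap K L a) = algebraMap K L (DK₂ a))
    (hrat : ∀ a : K, DK₁ a * Q - DK₂ a * P = 0 → DK₁ a = 0 ∧ DK₂ a = 0) {f : L} (hf : f ≠ 0)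
    (hclosed : D₂ (f * algebraMap K L P) = D₁ (f * algebraMap K L Q)) :
    ∃ r : K, minpoly K f = X ^ (minpoly K f).natDegree - C r := by
  set d := (minpoly K f).natDegree with hd
  have hfi : IsIntegral K f := Algebra.IsIntegral.isIntegral f
  set a₀ := (minpoly K f).coeff 0 with ha
  have ha0 : a₀ ≠ 0 := minpoly.coeff_zero_ne_zero hfi hf
  have hD : ∀ a, (algebraMap K L Q • D₁ - algebraMap K L P • D₂) (algebraMap K L a) =
      algebraMap K L ((Q • DK₁ - P • DK₂) a) := fun a => by simp [h₁, h₂, Algebra.smul_def]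
  have hDf : (algebraMap K L Q • D₁ - algebraMap K L P • D₂) f = (DK₂ P - DK₁ Q) • f := by
    simp only [Derivation.leibniz, h₁, h₂, smul_eq_mul] at hclosed
    simp [Algebra.smul_def]
    linear_combination -hclosed
  have ha₀ := derivation_coeff_minpoly hD hDf 0
  rw [← ha, ← hd, Nat.cast_zero, sub_zero] at ha₀
  have hinv : (algebraMap K L Q • D₁ - algebraMap K L P • D₂) (f ^ d / algebraMap K L a₀) = 0 := by
    have ha0' : algebraMap K L a₀ ≠ 0 := by simpa using ha0
    rw [Derivation.leibniz_div, Derivation.leibniz_pow, hDf, hD, ha₀]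
    simp only [smul_eq_mul, nsmul_eq_mul]
    simp only [Algebra.smul_def, map_mul, map_natCast]
    rcases hd' : d with _ | e
    · simp
    · simp only [Nat.add_sub_cancel]
      field_simp
      ring
  obtain ⟨z₁, z₂⟩ := derivations_eq_zero_of_first_integral (g := f ^ d / algebraMap K L a₀)
    h₁ h₂ hrat (by rw [← hinv]; simp [Algebra.smul_def]; ring)
  obtain ⟨z, hz⟩ := mem_range_of_derivations_eq_zero htr D₁ D₂ hx₁ hy₁ hy₂ z₁ z₂
  refine ⟨algebraMap k K z * a₀, ?_⟩
  have hpos : d ≠ 0 := (minpoly.natDegree_pos hfi).ne'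
  have ha0' : algebraMap K L a₀ ≠ 0 := by simpa using ha0
  refine (minpoly.unique_of_degree_le_degree_minpoly K f (monic_X_pow_sub_C _ hpos) ?_ ?_).symm
  · simp only [map_sub, map_pow, aeval_X, aeval_C, map_mul,
      ← IsScalarTower.algebraMap_apply k K L, hz]
    field_simp
    simp
  · rw [degree_X_pow_sub_C (Nat.pos_of_ne_zero hpos), degree_eq_natDegree (minpoly.ne_zero hfi)]

omit [CharZero K] [FiniteDimensional K L] in
theorem exists_algHom_apply_eq_mul {f : L} {d : ℕ} (hd : d ≠ 0) {r : K}
    (hr : minpoly K f = X ^ d - C r) (htop : K⟮f⟯ = ⊤) {z : K} (hz : z ^ d = 1) :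
    ∃ σ : L →ₐ[K] L, σ f = algebraMap K L z * f := by
  have hfi : IsIntegral K f := by
    refine minpoly.ne_zero_iff.1 ?_
    rw [hr]
    exact (monic_X_pow_sub_C _ hd).ne_zero
  let pb := (adjoin.powerBasis hfi).map ((equivOfEq htop).trans topEquiv)
  have hgen : pb.gen = f := by simp [pb]
  have h0 : aeval f (X ^ d - C r) = 0 := hr ▸ minpoly.aeval K f
  have hroot : aeval (algebraMap K L z * f) (minpoly K pb.gen) = 0 := by
    have hz' : algebraMap K L z ^ d = 1 := by rw [← map_pow, hz, map_one]
    rw [hgen, hr]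
    simpa [mul_pow, hz'] using h0
  exact ⟨pb.lift _ hroot, (congrArg _ hgen.symm).trans (pb.lift_gen _ hroot)⟩

omit [CharZero K] [FiniteDimensional K L] in
theorem derivation_eq_zero_of_algHom_logForm [CharZero k] [CharZero L] [Algebra.EssFiniteType k L]
    (htr : Algebra.trdeg k L ≤ 2) {y : L} (hy₁ : D₁ y = 0) (hy₂ : D₂ y ≠ 0) {m : ℕ}
    (c : Fin m → k) (ζ : k)
    (hind : ∀ j : Fin m ⊕ Fin m → ℤ,
      ∑ i, (j i : k) * Sum.elim c (fun i => ζ * c i) i = 0 → j = 0)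
    {u : Fin m → L} (hu : ∀ i, u i ≠ 0) (v : L) (σ : L →ₐ[K] L)
    (hσ : ∀ a, σ (D₁ a) = D₁ (σ a))
    (hform : σ (logForm D₁ c u v) = algebraMap k L ζ * logForm D₁ c u v) (i : Fin m) :
    D₁ (u i) = 0 := by
  have : Algebra.EssFiniteType D₁.constants L := .of_comp k _ L
  have hk : ∀ z : k, σ (algebraMap k L z) = algebraMap k L z := fun z => by
    rw [IsScalarTower.algebraMap_apply k K L, σ.commutes]
  have h := derivation_eq_zero_of_sum_logDeriv (trdeg_over_constants_le_one htr D₁ D₂ hy₁ hy₂)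
    (D₁.extendConstants D₁.constants fun c => c.2)
    (fun i => algebraMap k D₁.constants (Sum.elim c (fun i => ζ * c i) i)) ?_
    (Sum.elim (fun i => σ (u i)) (fun i => (u i)⁻¹)) ?_ (σ v - algebraMap k L ζ * v) ?_ (Sum.inr i)
  · change D₁ (u i)⁻¹ = 0 at h
    rw [Derivation.leibniz_inv] at h
    simpa [hu i] using h
  · intro j hj
    refine hind j ((algebraMap k D₁.constants).injective ?_)
    simpa using hj
  · rintro (i | i)
    · simpa using hu i
    · simpa using hu i
  · change ∑ i, algebraMap k L (Sum.elim c (fun i => ζ * c i) i) *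
      (D₁ (Sum.elim (fun i => σ (u i)) (fun i => (u i)⁻¹) i) /
        Sum.elim (fun i => σ (u i)) (fun i => (u i)⁻¹) i) + D₁ (σ v - algebraMap k L ζ * v) = 0
    have hneg : ∀ i, D₁ (u i)⁻¹ / (u i)⁻¹ = -(D₁ (u i) / u i) := fun i => by
      have := hu i
      rw [Derivation.leibniz_inv, smul_eq_mul]
      field_simp
    rw [← sub_eq_zero] at hform
    rw [← hform]
    simp only [logForm, map_add, map_sum, map_mul, map_div₀, hk, hσ, Fintype.sum_sum_type,
      Sum.elim_inl, Sum.elim_inr, hneg, map_sub, Derivation.leibniz, Derivation.map_algebraMap,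
      smul_eq_mul, mul_add, Finset.mul_sum, mul_neg, Finset.sum_neg_distrib, mul_assoc]
    ring
end

section
open IntermediateField Polynomial

variable {k K L : Type} [Field k] [Field K] [Field L] [Algebra k K] [Algebra k L]
  [Algebra K L] [IsScalarTower k K L] {DK₁ DK₂ : Derivation k K K} {D₁ D₂ : Derivation k L L}
  {P Q : K} [FiniteDimensional K L]

theorem logForm_trace_eq (F : IntermediateField K L) {D : Derivation k L L}
    {DK : Derivation k K K} (hD : ∀ a, D (algebraMap K L a) = algebraMap K L (DK a))
    [CharZero K] {m : ℕ} (c : Fin m → k) {u : Fin m → L} (hu : ∀ i, u i ≠ 0) (v : L) {f : L}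
    (hf : f ∈ F) {R : K} (hform : logForm D c u v = f * algebraMap K L R) :
    logForm D c (fun i => (Algebra.norm F (u i) : L)) (Algebra.trace F L v : L) =
      Module.finrank F L * (f * algebraMap K L R) := by
  rw [← trace_logForm F (fun a ha => derivation_mem_intermediateField hD F ha) c hu v, hform]
  have h := Algebra.trace_algebraMap (R := F) (S := L) (⟨f, hf⟩ * algebraMap K F R)
  simpa using congrArg (algebraMap F L) h

/-- If the form `∑ cᵢ duᵢ/uᵢ + dv` over `L` is proportional to `P dx + Q dy`, if `L` is minimal with
this property, and if there is no rational first integral, then the constants `cᵢ`, `ζ cᵢ` satisfy a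
nontrivial integral linear relation for every `[L : K]`-th root of unity `ζ`. -/
theorem exists_int_relation_of_minimal [CharZero k] [CharZero K] [CharZero L] [IsAlgClosed k]
    {x y : K} (hx₁ : DK₁ x = 1) (hy₁ : DK₁ y = 0) (hx₂ : DK₂ x = 0) (hy₂ : DK₂ y = 1)
    (hgen : IntermediateField.adjoin k {x, y} = ⊤)
    (hcomm : ∀ a, DK₁ (DK₂ a) = DK₂ (DK₁ a))
    (h₁ : ∀ a, D₁ (algebraMap K L a) = algebraMap K L (DK₁ a))
    (h₂ : ∀ a, D₂ (algebraMap K L a) = algebraMap K L (DK₂ a))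
    (hPQ : ¬(P = 0 ∧ Q = 0))
    (hrat : ∀ a : K, DK₁ a * Q - DK₂ a * P = 0 → DK₁ a = 0 ∧ DK₂ a = 0)
    {m : ℕ} (c : Fin m → k) {u : Fin m → L} (hu : ∀ i, u i ≠ 0) (v : L)
    (hwedge : logForm D₁ c u v * algebraMap K L Q - logForm D₂ c u v * algebraMap K L P = 0)
    (hne : logForm D₁ c u v ≠ 0 ∨ logForm D₂ c u v ≠ 0)
    (hmin : ∀ (F : IntermediateField K L) (u' : Fin m → L) (v' : L),
      (∀ i, u' i ∈ F) → v' ∈ F → (∀ i, u' i ≠ 0) →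
      logForm D₁ c u' v' * algebraMap K L Q - logForm D₂ c u' v' * algebraMap K L P = 0 →
      (logForm D₁ c u' v' ≠ 0 ∨ logForm D₂ c u' v' ≠ 0) → F = ⊤)
    {ζ : k} (hζ : ζ ^ Module.finrank K L = 1) :
    ∃ j : Fin m ⊕ Fin m → ℤ,
      ∑ i, (j i : k) * Sum.elim c (fun i => ζ * c i) i = 0 ∧ j ≠ 0 := by
  by_contra! hind
  have htr : Algebra.trdeg k L ≤ 2 := trdeg_le_two_of_adjoin_eq_top hgen
  have : Algebra.EssFiniteType k L := essFiniteType_of_adjoin_eq_top (Set.toFinite _) hgen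
  have hX₁ : D₁ (algebraMap K L x) ≠ 0 := by simp [h₁, hx₁]
  have hX₂ : D₂ (algebraMap K L x) = 0 := by simp [h₂, hx₂]
  have hY₁ : D₁ (algebraMap K L y) = 0 := by simp [h₁, hy₁]
  have hY₂ : D₂ (algebraMap K L y) ≠ 0 := by simp [h₂, hy₂]
  obtain ⟨f, hf₁, hf₂⟩ : ∃ f, logForm D₁ c u v = f * algebraMap K L P ∧
      logForm D₂ c u v = f * algebraMap K L Q := by
    by_cases hP : P = 0
    · have hQ : algebraMap K L Q ≠ 0 := by simpa using fun h => hPQ ⟨hP, h⟩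
      refine ⟨logForm D₂ c u v / algebraMap K L Q, ?_, by field_simp⟩
      rw [hP, map_zero, mul_zero, sub_zero] at hwedge
      rw [hP, map_zero, mul_zero]
      exact (mul_eq_zero.1 hwedge).resolve_right hQ
    · have hP' : algebraMap K L P ≠ 0 := by simpa using hP
      refine ⟨logForm D₁ c u v / algebraMap K L P, by field_simp, ?_⟩
      field_simp
      linear_combination -hwedge
  have hf : f ≠ 0 := by
    rintro rfl
    simp [hf₁, hf₂] at hne
  have htop : K⟮f⟯ = ⊤ := by
    have hmem := mem_adjoin_simple_self K f
    have hn : (Module.finrank K⟮f⟯ L : L) ≠ 0 := Nat.cast_ne_zero.2 Module.finrank_pos.ne'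
    refine hmin K⟮f⟯ (fun i => (Algebra.norm K⟮f⟯ (u i) : L)) (Algebra.trace K⟮f⟯ L v : L)
      (fun i => Subtype.prop _) (Subtype.prop _) (fun i => ?_) ?_ ?_
    · simpa [Algebra.norm_eq_zero_iff] using hu i
    · rw [logForm_trace_eq _ h₁ c hu v hmem hf₁, logForm_trace_eq _ h₂ c hu v hmem hf₂]
      ring
    · rw [logForm_trace_eq _ h₁ c hu v hmem hf₁, logForm_trace_eq _ h₂ c hu v hmem hf₂,
        ← hf₁, ← hf₂]
      simpa [hn] using hne
  have hcommL := derivation_comm h₁ h₂ hcomm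
  obtain ⟨r, hr⟩ := minpoly_eq_X_pow_sub_C htr hX₁ hY₁ hY₂ h₁ h₂ hrat hf
    (by rw [← hf₁, ← hf₂, derivation_logForm_comm hcommL])
  have hdeg : (minpoly K f).natDegree = Module.finrank K L := by
    rw [← adjoin.finrank (Algebra.IsIntegral.isIntegral f), htop, finrank_top']
  rw [hdeg] at hr
  obtain ⟨σ, hσ⟩ := exists_algHom_apply_eq_mul Module.finrank_pos.ne' hr htop
    (z := algebraMap k K ζ) (by rw [← map_pow, hζ, map_one])
  rw [← IsScalarTower.algebraMap_apply k K L] at hσ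
  have hu₁ := derivation_eq_zero_of_algHom_logForm htr hY₁ hY₂ c ζ hind hu v σ
    (algHom_derivation h₁ σ) (by rw [hf₁, map_mul, hσ, σ.commutes, mul_assoc])
  have hu₂ := derivation_eq_zero_of_algHom_logForm htr hX₂ hX₁ c ζ hind hu v σ
    (algHom_derivation h₂ σ) (by rw [hf₂, map_mul, hσ, σ.commutes, mul_assoc])
  have hv₁ : logForm D₁ c u v = D₁ v := by simp [logForm, hu₁]
  have hv₂ : logForm D₂ c u v = D₂ v := by simp [logForm, hu₂]
  rw [hv₁, hv₂] at hwedge hne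
  obtain ⟨z₁, z₂⟩ := derivations_eq_zero_of_first_integral h₁ h₂ hrat hwedge
  exact hne.elim (· z₁) (· z₂)
end

/-- Proposition `czeta`. Let ω be exceptional and L a minimal
algebraic extension of K = ℂ(x,y), of degree n > 1, carrying a Prelle–Singer relation
whose constants c₁,…,c_m are ℚ-linearly independent. Then for any primitive n-th root
of unity ζ, the numbers c₁,…,c_m, ζc₁,…,ζc_m are ℚ-linearly dependent. -/
theorem constants_zeta_dependent
    {K : Type} [Field K] [CharZero K] [Algebra ℂ K]
    (x y : K) (Dx Dy : Derivation ℚ K K)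
    (hxx : Dx x = 1) (hxy : Dx y = 0) (hyx : Dy x = 0) (hyy : Dy y = 1)
    (hDxC : ∀ z : ℂ, Dx (algebraMap ℂ K z) = 0)
    (hDyC : ∀ z : ℂ, Dy (algebraMap ℂ K z) = 0)
    (hcomm : ∀ a : K, Dx (Dy a) = Dy (Dx a))
    (hgen : IntermediateField.adjoin ℂ {x, y} = ⊤)
    (hind : AlgebraicIndependent ℂ ![x, y])
    (P Q : K) (hω : ¬ (P = 0 ∧ Q = 0))
    (hexc : IsExceptional Dx Dy P Q)
    {E : DiffExt K Dx Dy}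
    (hn : 1 < Module.finrank K E.M)
    (hmin : ∀ L' : IntermediateField K E.M, RelIn E P Q L' → L' = ⊤)
    (m : ℕ) (c : Fin m → ℂ) (u : Fin m → E.M) (v : E.M)
    (hPS : PSRel E.DX E.DY (algebraMap K E.M P) (algebraMap K E.M Q)
      (fun i => algebraMap K E.M (algebraMap ℂ K (c i))) u v)
    (hcind : LinearIndependent ℚ c) :
    ∀ ζ : ℂ, IsPrimitiveRoot ζ (Module.finrank K E.M) →
      ¬ LinearIndependent ℚ (Fin.append c (fun i => ζ * c i)) := by
  obtain ⟨hu, hwedge, hne⟩ := hPS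
  intro ζ hζ hlin
  let : Algebra ℂ E.M := ((algebraMap K E.M).comp (algebraMap ℂ K)).toAlgebra
  have : IsScalarTower ℂ K E.M := .of_algebraMap_eq fun _ => rfl
  have := E.finite
  have hX : ∀ z : ℂ, E.DX (algebraMap ℂ E.M z) = 0 := fun z => by
    rw [IsScalarTower.algebraMap_apply ℂ K E.M, E.extX, hDxC, map_zero]
  have hY : ∀ z : ℂ, E.DY (algebraMap ℂ E.M z) = 0 := fun z => by
    rw [IsScalarTower.algebraMap_apply ℂ K E.M, E.extY, hDyC, map_zero]
  have hrat : ∀ a : K, Dx a * Q - Dy a * P = 0 → Dx a = 0 ∧ Dy a = 0 := by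
    intro a ha
    by_contra hne'
    refine hexc.2 ⟨0, Fin.elim0, Fin.elim0, a, fun i => i.elim0, ?_, ?_⟩
    · simpa [psC] using ha
    · simpa [psC, imp_iff_not_or] using hne'
  obtain ⟨j, hj, hj0⟩ := exists_int_relation_of_minimal
    (DK₁ := Dx.extendConstants ℂ hDxC) (DK₂ := Dy.extendConstants ℂ hDyC)
    (D₁ := E.DX.extendConstants ℂ hX) (D₂ := E.DY.extendConstants ℂ hY)
    hxx hxy hyx hyy hgen hcomm E.extX E.extY hω hrat c hu v hwedge hne
    (fun F u' v' hu' hv' h0 hw hn' => hmin F ⟨m, c, u', v', hu', hv', h0, hw, hn'⟩) hζ.pow_eq_one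
  rw [← linearIndependent_equiv finSumFinEquiv] at hlin
  refine hj0 (funext fun i => ?_)
  have h := Fintype.linearIndependent_iff.1 hlin (fun i => (j i : ℚ)) ?_ i
  · exact_mod_cast h
  · rw [← hj]
    refine Finset.sum_congr rfl fun i _ => ?_
    rcases i with i | i
    · simp [Algebra.smul_def]
    · rw [Function.comp_apply, finSumFinEquiv_apply_right, Fin.append_right]
      simp [Algebra.smul_def]
end
end

section
/- Let K = ℂ(x,y), let ω be a nonzero one-form over K which is exceptional, and let L be a minimal algebraic extension of K over which a Prelle–Singer relation for ω holds with constants c₁,…,c_m ∈ ℂ linearly independent over ℚ. If for every n ≥ 3 and every primitive n-th root of unity ζ the numbers c₁,…,c_m, ζc₁,…,ζc_m are linearly independent over ℚ, then [L : K] = 2. In particular, whenever the relation holds with m = 1 (so that the vector field admits an elementary first integral of the form c·log u + v), then [L : K] = 2. -/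
noncomputable section

variable (K : Type) [Field K] [CharZero K] [Algebra ℂ K]

variable {K}

namespace PrelleSinger

open Polynomial

section Derivations

variable {R F M : Type*} [CommRing R] [Field F] [Field M] [Algebra R M]
  [Algebra F M]

lemma derivation_aeval_of_const (D : Derivation R M M)
    (hD : ∀ a, D (algebraMap F M a) = 0) (p : F[X]) (x : M) :
    D (aeval x p) = aeval x (derivative p) * D x := by
  induction p using Polynomial.induction_on' with
  | add p q hp hq => simp [hp, hq, add_mul]
  | monomial n a => simp [derivative_monomial, Derivation.leibniz_pow, hD]; ring

/-- A derivation that vanishes on `F` vanishes on every element algebraic over `F`. -/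
lemma derivation_eq_zero_of_isAlgebraic [CharZero F] (D : Derivation R M M)
    (hD : ∀ a, D (algebraMap F M a) = 0) {x : M} (hx : IsAlgebraic F x) : D x = 0 := by
  have h := derivation_aeval_of_const D hD (minpoly F x) x
  rw [minpoly.aeval, map_zero, eq_comm, mul_eq_zero] at h
  exact h.resolve_left
    (((minpoly.irreducible hx.isIntegral).separable).aeval_derivative_ne_zero (minpoly.aeval F x))

variable [Algebra R F]

lemma derivation_aeval_eq_sum (D₀ : Derivation R F F) (D : Derivation R M M)
    (hD : ∀ a, D (algebraMap F M a) = algebraMap F M (D₀ a)) (p : F[X]) (x : M) :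
    D (aeval x p) = ∑ i ∈ Finset.range (p.natDegree + 1),
      (algebraMap F M (D₀ (p.coeff i)) * x ^ i +
        algebraMap F M (p.coeff i) * (i * x ^ (i - 1) * D x)) := by
  rw [aeval_eq_sum_range, map_sum]
  refine Finset.sum_congr rfl fun i _ ↦ ?_
  rw [Algebra.smul_def, Derivation.leibniz, Derivation.leibniz_pow, hD]
  simp only [smul_eq_mul, nsmul_eq_mul]
  ring

/-- If `D g = h g` with `h` in the base field, then each coefficient of the minimal polynomial
of `g` satisfies an equation of the same kind. -/
lemma derivation_coeff_minpoly (D₀ : Derivation R F F) (D : Derivation R M M)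
    (hD : ∀ a, D (algebraMap F M a) = algebraMap F M (D₀ a)) {g : M} {h : F}
    (hg : IsIntegral F g) (hDg : D g = algebraMap F M h * g) (i : ℕ) :
    D₀ ((minpoly F g).coeff i) =
      ((minpoly F g).natDegree - i : F) * h * (minpoly F g).coeff i := by
  set p := minpoly F g with hp
  set n := p.natDegree with hn
  let e : ℕ → F := fun i ↦ D₀ (p.coeff i) - (n - i : F) * h * p.coeff i
  let q : F[X] := ∑ i ∈ Finset.range (n + 1), monomial i (e i)
  have hpn : p.coeff n = 1 := minpoly.monic hg
  have hen : e n = 0 := by simp [e, hpn]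
  have hqi : ∀ j, q.coeff j = if j < n + 1 then e j else 0 := by
    intro j
    simp [q, coeff_monomial]
  have hq0 : q = 0 := by
    by_contra hq
    have h1 := minpoly.degree_le_of_ne_zero F g hq (by
      have h2 := derivation_aeval_eq_sum D₀ D hD p g
      have h3 : aeval g p = 0 := minpoly.aeval F g
      have h4 : ∑ i ∈ Finset.range (n + 1), algebraMap F M (p.coeff i) * g ^ i = 0 := by
        rw [← h3, aeval_eq_sum_range]
        simp [Algebra.smul_def, hn]
      rw [h3, map_zero] at h2
      have h5 : aeval g q = D (aeval g p) - n * algebraMap F M h *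
          ∑ i ∈ Finset.range (n + 1), algebraMap F M (p.coeff i) * g ^ i := by
        rw [derivation_aeval_eq_sum D₀ D hD, ← hn, Finset.mul_sum, ← Finset.sum_sub_distrib]
        simp only [q, map_sum, aeval_monomial]
        refine Finset.sum_congr rfl fun i _ ↦ ?_
        rcases i with _ | i
        · simp [e]
        · simp [e, hDg]; ring
      rw [h5, h4, h3]; simp)
    rw [← hp, degree_eq_natDegree (minpoly.ne_zero hg), ← hn] at h1
    refine absurd ((degree_lt_iff_coeff_zero q n).2 fun j hj ↦ ?_) (not_lt.2 h1)
    rw [hqi]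
    split_ifs with hj'
    · rw [show j = n by omega, hen]
    · rfl
  by_cases hi : i < n + 1
  · have := hqi i
    rw [hq0, if_pos hi, coeff_zero, eq_comm, sub_eq_zero] at this
    exact this
  · rw [coeff_eq_zero_of_natDegree_lt (by omega)]
    simp

end Derivations

section Trace

open Differential

lemma logDeriv_norm_and_trace_of_isGalois {F N : Type*} [Field F] [CharZero F] [Field N]
    [Algebra F N] [Differential F] [Differential N] [DifferentialAlgebra F N]
    [FiniteDimensional F N] [IsGalois F N] (u : N) :
    (u ≠ 0 → Algebra.trace F N (logDeriv u) = logDeriv (Algebra.norm F u)) ∧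
      Algebra.trace F N u′ = (Algebra.trace F N u)′ := by
  refine ⟨fun hu ↦ (algebraMap F N).injective ?_, (algebraMap F N).injective ?_⟩
  · rw [trace_eq_sum_automorphisms, ← logDeriv_algebraMap, Algebra.norm_eq_prod_automorphisms,
      Differential.logDeriv_prod]
    · refine Finset.sum_congr rfl fun σ _ ↦ ?_
      rw [Differential.logDeriv, Differential.logDeriv, map_div₀, algEquiv_deriv']
    · intro σ _
      simpa using hu
  · rw [trace_eq_sum_automorphisms, ← deriv_algebraMap, trace_eq_sum_automorphisms, map_sum]
    exact Finset.sum_congr rfl fun σ _ ↦ algEquiv_deriv' σ u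

/-- The trace turns logarithmic derivatives into logarithmic derivatives of norms, and commutes
with derivations. -/
lemma logDeriv_norm_and_trace {F M : Type*} [Field F] [CharZero F] [Field M]
    [Algebra F M] [Differential F] [Differential M] [DifferentialAlgebra F M]
    [FiniteDimensional F M] (u : M) :
    (u ≠ 0 → Algebra.trace F M (logDeriv u) = logDeriv (Algebra.norm F u)) ∧
      Algebra.trace F M u′ = (Algebra.trace F M u)′ := by
  have : CharZero M := charZero_of_injective_algebraMap (algebraMap F M).injective
  let N := IntermediateField.normalClosure F M (AlgebraicClosure M)
  have : FiniteDimensional M N := FiniteDimensional.right F M N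
  have : CharZero N := charZero_of_injective_algebraMap (algebraMap F N).injective
  let : Differential N := differentialFiniteDimensional F N
  have : DifferentialAlgebra F N := differentialAlgebraFiniteDimensional
  have : DifferentialAlgebra M N :=
    ⟨fun a ↦ (algHom_deriv' (IsScalarTower.toAlgHom F M N)
      (IsScalarTower.toAlgHom F M N).injective a).symm⟩
  have : IsGalois F N := {}
  have hd : (Module.finrank M N : F) ≠ 0 := by
    exact_mod_cast Module.finrank_pos.ne'
  have hT : ∀ a : M, Algebra.trace F N (algebraMap M N a) =
      Module.finrank M N * Algebra.trace F M a := by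
    intro a
    rw [← Algebra.trace_trace (S := M), Algebra.trace_algebraMap, map_nsmul, nsmul_eq_mul]
  obtain ⟨h1, h2⟩ := logDeriv_norm_and_trace_of_isGalois (F := F) (algebraMap M N u)
  constructor
  · intro hu
    have h := h1 (by simpa using hu)
    rw [logDeriv_algebraMap, hT, ← Algebra.norm_norm (S := M), Algebra.norm_algebraMap, map_pow,
      Differential.logDeriv_pow] at h
    exact mul_left_cancel₀ hd h
  · rw [deriv_algebraMap, hT, hT, Derivation.leibniz] at h2
    simp only [Derivation.map_natCast, smul_eq_mul, mul_zero, add_zero] at h2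
    exact mul_left_cancel₀ hd h2

lemma trace_derivation_div {F M : Type*} [Field F] [CharZero F] [Field M]
    [Algebra F M] [FiniteDimensional F M] {R : Type*} [CommRing R] [Algebra R F] [Algebra R M]
    (D₀ : Derivation R F F) (D : Derivation R M M)
    (hD : ∀ a, D (algebraMap F M a) = algebraMap F M (D₀ a)) {u : M} (hu : u ≠ 0) :
    Algebra.trace F M (D u / u) = D₀ (Algebra.norm F u) / Algebra.norm F u := by
  let : Differential F := ⟨D₀.restrictScalars ℤ⟩
  let : Differential M := ⟨D.restrictScalars ℤ⟩
  have : DifferentialAlgebra F M := ⟨hD⟩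
  exact (logDeriv_norm_and_trace (F := F) u).1 hu

lemma trace_derivation {F M : Type*} [Field F] [CharZero F] [Field M]
    [Algebra F M] [FiniteDimensional F M] {R : Type*} [CommRing R] [Algebra R F] [Algebra R M]
    (D₀ : Derivation R F F) (D : Derivation R M M)
    (hD : ∀ a, D (algebraMap F M a) = algebraMap F M (D₀ a)) (v : M) :
    Algebra.trace F M (D v) = D₀ (Algebra.trace F M v) := by
  let : Differential F := ⟨D₀.restrictScalars ℤ⟩
  let : Differential M := ⟨D.restrictScalars ℤ⟩
  have : DifferentialAlgebra F M := ⟨hD⟩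
  exact (logDeriv_norm_and_trace (F := F) v).2

/-- A derivation of an algebraic extension commutes with the endomorphisms of that extension. -/
lemma algHom_derivation {F M : Type*} [Field F] [CharZero F] [Field M]
    [Algebra F M] [Algebra.IsAlgebraic F M] {R : Type*} [CommRing R] [Algebra R F] [Algebra R M]
    (D₀ : Derivation R F F) (D : Derivation R M M)
    (hD : ∀ a, D (algebraMap F M a) = algebraMap F M (D₀ a)) (σ : M →ₐ[F] M) (v : M) :
    σ (D v) = D (σ v) := by
  let : Differential F := ⟨D₀.restrictScalars ℤ⟩
  let : Differential M := ⟨D.restrictScalars ℤ⟩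
  have : DifferentialAlgebra F M := ⟨hD⟩
  exact algHom_deriv' σ σ.injective v

/-- A derivation of a finite extension that preserves the base field preserves every intermediate
field. -/
lemma derivation_mem_intermediateField {F M : Type*} [Field F] [CharZero F] [Field M]
    [Algebra F M] [FiniteDimensional F M] {R : Type*} [CommRing R] [Algebra R F] [Algebra R M]
    (D₀ : Derivation R F F) (D : Derivation R M M)
    (hD : ∀ a, D (algebraMap F M a) = algebraMap F M (D₀ a)) (L : IntermediateField F M) :
    ∀ a ∈ L, D a ∈ L := by
  let : Differential F := ⟨D₀.restrictScalars ℤ⟩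
  let : Differential M := ⟨D.restrictScalars ℤ⟩
  have : DifferentialAlgebra F M := ⟨hD⟩
  intro a ha
  have h := deriv_algebraMap (A := L) (B := M) ⟨a, ha⟩
  change D a = _ at h
  rw [h]
  exact SetLike.coe_mem _

/-- The restriction of a derivation to a stable intermediate field. -/
def restrictDerivation {F M : Type*} [Field F] [Field M] [Algebra F M] {R : Type*} [CommRing R]
    [Algebra R M] (D : Derivation R M M) (L : IntermediateField F M)
    (hL : ∀ a ∈ L, D a ∈ L) : Derivation ℤ L L :=
  Derivation.mk'
    (AddMonoidHom.toIntLinearMap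
      { toFun := fun a ↦ ⟨D a, hL a a.2⟩
        map_zero' := by ext; simp
        map_add' := fun a b ↦ by ext; simp })
    (fun a b ↦ by ext; simp)

lemma algebraMap_restrictDerivation {F M : Type*} [Field F] [Field M] [Algebra F M] {R : Type*}
    [CommRing R] [Algebra R M] (D : Derivation R M M) (L : IntermediateField F M)
    (hL : ∀ a ∈ L, D a ∈ L) (a : L) :
    D.restrictScalars ℤ (algebraMap L M a) = algebraMap L M (restrictDerivation D L hL a) :=
  rfl

end Trace

section Residues

open IntermediateField

variable {k M : Type*} [Field k] [Field M] [Algebra k M]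

/-- The elements of `k(w)` that are regular at `w = 0`. -/
def regularAtZero {w : M} (hw : Transcendental k w) : Subalgebra k M where
  carrier := {r | ∃ a b : k[X], b.coeff 0 ≠ 0 ∧ r = aeval w a / aeval w b}
  mul_mem' := by
    rintro _ _ ⟨a, b, hb, rfl⟩ ⟨a', b', hb', rfl⟩
    exact ⟨a * a', b * b', by simp [mul_coeff_zero, hb, hb'], by simp [div_mul_div_comm]⟩
  add_mem' := by
    rintro _ _ ⟨a, b, hb, rfl⟩ ⟨a', b', hb', rfl⟩
    have h : ∀ p : k[X], p.coeff 0 ≠ 0 → aeval w p ≠ 0 := fun p hp h ↦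
      hp (by rw [(transcendental_iff.1 hw) p h, coeff_zero])
    refine ⟨a * b' + b * a', b * b', by simp [mul_coeff_zero, hb, hb'], ?_⟩
    rw [div_add_div _ _ (h b hb) (h b' hb')]
    simp
  algebraMap_mem' c := ⟨C c, 1, by simp, by simp⟩

variable {w : M} (hw : Transcendental k w)

include hw in
lemma aeval_ne_zero_of_transcendental {p : k[X]} (hp : p ≠ 0) : aeval w p ≠ 0 :=
  fun h ↦ hp ((transcendental_iff.1 hw) p h)

lemma self_mem_regularAtZero : w ∈ regularAtZero hw := ⟨X, 1, by simp, by simp⟩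

lemma inv_notMem_regularAtZero : w⁻¹ ∉ regularAtZero hw := by
  rintro ⟨a, b, hb, h⟩
  have hb' : aeval w b ≠ 0 := aeval_ne_zero_of_transcendental hw (by rintro rfl; simp at hb)
  have hw0 : w ≠ 0 := by simpa using aeval_ne_zero_of_transcendental hw X_ne_zero
  have h2 : aeval w (b - X * a) = 0 := by
    field_simp at h
    simp [h]
  have h3 := (transcendental_iff.1 hw) _ h2
  apply hb
  simpa using congrArg (coeff · 0) h3

lemma derivation_mem_regularAtZero {R : Type*} [CommRing R] [Algebra R M] (D : Derivation R M M)
    (hD : ∀ a, D (algebraMap k M a) = 0) (hDw : D w = 1) {r : M} (hr : r ∈ regularAtZero hw) :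
    D r ∈ regularAtZero hw := by
  obtain ⟨a, b, hb, rfl⟩ := hr
  have hb' : aeval w b ≠ 0 := aeval_ne_zero_of_transcendental hw (by rintro rfl; simp at hb)
  refine ⟨b * derivative a - a * derivative b, b ^ 2, by simpa [pow_two, mul_coeff_zero], ?_⟩
  rw [Derivation.leibniz_div, derivation_aeval_of_const D hD, derivation_aeval_of_const D hD, hDw]
  simp
  field_simp

lemma exists_aeval_eq_pow_mul (w : M) {a : k[X]} (ha : a ≠ 0) :
    ∃ (n : ℕ) (b : k[X]), b.coeff 0 ≠ 0 ∧ aeval w a = w ^ n * aeval w b := by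
  obtain ⟨b, h1, h2⟩ := exists_eq_pow_rootMultiplicity_mul_and_not_dvd a ha 0
  rw [C_0, sub_zero] at h1 h2
  refine ⟨rootMultiplicity 0 a, b, fun h ↦ h2 (X_dvd_iff.2 h), ?_⟩
  have h3 := congrArg (aeval w) h1
  rwa [map_mul, map_pow, aeval_X] at h3

/-- Every nonzero element of `k(w)` is a power of `w` times a unit at `w = 0`. -/
lemma exists_eq_zpow_mul_regularAtZero {f : M} (hf : f ∈ k⟮w⟯) (hf0 : f ≠ 0) :
    ∃ (n : ℤ) (r : M), r ≠ 0 ∧ r ∈ regularAtZero hw ∧ r⁻¹ ∈ regularAtZero hw ∧ f = w ^ n * r := by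
  obtain ⟨a, b, rfl⟩ := (mem_adjoin_simple_iff k f).1 hf
  have hw0 : w ≠ 0 := by simpa using aeval_ne_zero_of_transcendental hw X_ne_zero
  have ha : a ≠ 0 := by rintro rfl; simp at hf0
  have hb : b ≠ 0 := by rintro rfl; simp at hf0
  obtain ⟨n, a', ha', h1⟩ := exists_aeval_eq_pow_mul w ha
  obtain ⟨m, b', hb', h2⟩ := exists_aeval_eq_pow_mul w hb
  have ha0 : aeval w a' ≠ 0 := aeval_ne_zero_of_transcendental hw (by rintro rfl; simp at ha')
  have hb0 : aeval w b' ≠ 0 := aeval_ne_zero_of_transcendental hw (by rintro rfl; simp at hb')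
  refine ⟨n - m, aeval w a' / aeval w b', div_ne_zero ha0 hb0, ⟨a', b', hb', rfl⟩,
    ⟨b', a', ha', by rw [inv_div]⟩, ?_⟩
  rw [h1, h2, zpow_sub₀ hw0, zpow_natCast, zpow_natCast, div_mul_div_comm]

/-- The sum of the residues at `w = 0` of a vanishing form `∑ cᵢ dfᵢ/fᵢ + dv` over `k(w)`. -/
lemma sum_mul_order_eq_zero [CharZero k] {R : Type*} [CommRing R] [Algebra R M]
    (D : Derivation R M M) (hD : ∀ a, D (algebraMap k M a) = 0) (hDw : D w = 1)
    {ι : Type*} [Fintype ι] (c : ι → k) (n : ι → ℤ) (r : ι → M) (hr0 : ∀ i, r i ≠ 0)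
    (hr : ∀ i, r i ∈ regularAtZero hw) (hr' : ∀ i, (r i)⁻¹ ∈ regularAtZero hw)
    {v : M} (hv : v ∈ k⟮w⟯)
    (h : ∑ i, algebraMap k M (c i) * (D (w ^ n i * r i) / (w ^ n i * r i)) + D v = 0) :
    ∑ i, c i * n i = 0 := by
  have hw0 : w ≠ 0 := by simpa using aeval_ne_zero_of_transcendental hw X_ne_zero
  have : CharZero M := charZero_of_injective_algebraMap (algebraMap k M).injective
  set O := regularAtZero hw with hO
  set s := ∑ i, c i * n i with hs
  have hwO : w ∈ O := self_mem_regularAtZero hw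
  have hDO : ∀ {r}, r ∈ O → D r ∈ O := fun hr ↦ derivation_mem_regularAtZero hw D hD hDw hr
  have key : algebraMap k M s * w⁻¹ +
      ∑ i, algebraMap k M (c i) * (D (r i) * (r i)⁻¹) + D v = 0 := by
    rw [← h, hs, map_sum, Finset.sum_mul, ← Finset.sum_add_distrib]
    congr 1
    refine Finset.sum_congr rfl fun i _ ↦ ?_
    have h1 := hr0 i
    have h2 : w ^ n i ≠ 0 := zpow_ne_zero _ hw0
    rw [Derivation.leibniz, Derivation.leibniz_zpow, hDw, zpow_sub_one₀ hw0]
    simp only [smul_eq_mul, zsmul_eq_mul, map_mul, map_intCast]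
    field_simp
    ring
  have hreg : ∑ i, algebraMap k M (c i) * (D (r i) * (r i)⁻¹) ∈ O :=
    sum_mem fun i _ ↦ mul_mem (O.algebraMap_mem _) (mul_mem (hDO (hr i)) (hr' i))
  set e := ∑ i, algebraMap k M (c i) * (D (r i) * (r i)⁻¹) with he
  have hex : ∃ N : ℕ, w ^ N * v ∈ O := by
    by_cases hv0 : v = 0
    · exact ⟨0, by simp [hv0, O.zero_mem]⟩
    obtain ⟨l, t, -, ht, -, rfl⟩ := exists_eq_zpow_mul_regularAtZero hw hv hv0
    refine ⟨l.natAbs, ?_⟩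
    rw [← mul_assoc, ← zpow_natCast, ← zpow_add₀ hw0]
    obtain ⟨j, hj⟩ := Int.eq_ofNat_of_zero_le (show 0 ≤ (l.natAbs : ℤ) + l by omega)
    rw [hj, zpow_natCast]
    exact mul_mem (pow_mem hwO _) ht
  classical
  have hspec := Nat.find_spec hex
  have hmin := fun m ↦ Nat.find_min hex (m := m)
  generalize Nat.find hex = N at hspec hmin
  rcases N with _ | N
  · by_contra hs0
    apply inv_notMem_regularAtZero hw
    have h1 : algebraMap k M s * w⁻¹ ∈ O := by
      rw [show algebraMap k M s * w⁻¹ = -(e + D v) by linear_combination key]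
      exact neg_mem (add_mem hreg (hDO (by simpa using hspec)))
    have h2 := mul_mem (O.algebraMap_mem s⁻¹) h1
    rwa [← mul_assoc, ← map_mul, inv_mul_cancel₀ hs0, map_one, one_mul] at h2
  · exfalso
    apply hmin N (by omega)
    have h1 := hDO hspec
    rw [Derivation.leibniz, Derivation.leibniz_pow, hDw] at h1
    simp only [smul_eq_mul, nsmul_eq_mul, Nat.add_sub_cancel, mul_one] at h1
    have h2 : w ^ (N + 1) * D v ∈ O := by
      have h3 : w ^ (N + 1) * D v = -(algebraMap k M s * w ^ N + w ^ (N + 1) * e) := by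
        have h4 : w ^ (N + 1) * w⁻¹ = w ^ N := by rw [pow_succ, mul_inv_cancel_right₀ hw0]
        linear_combination w ^ (N + 1) * key - algebraMap k M s * h4
      rw [h3]
      exact neg_mem (add_mem (mul_mem (O.algebraMap_mem _) (pow_mem hwO _))
        (mul_mem (pow_mem hwO _) hreg))
    have h5 := mul_mem (O.algebraMap_mem ((N + 1 : ℕ) : k)⁻¹) (sub_mem h1 h2)
    have h6 : ((N + 1 : ℕ) : M) ≠ 0 := by exact_mod_cast Nat.succ_ne_zero N
    convert h5 using 1
    rw [map_inv₀, map_natCast]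
    field_simp
    ring

lemma derivation_mem_adjoin_simple {R : Type*} [CommRing R] [Algebra R M] (D : Derivation R M M)
    (hD : ∀ a, D (algebraMap k M a) = 0) {w : M} (hDw : D w ∈ k⟮w⟯) : ∀ a ∈ k⟮w⟯, D a ∈ k⟮w⟯ := by
  intro a ha
  obtain ⟨p, q, rfl⟩ := (mem_adjoin_simple_iff k a).1 ha
  have hmem : ∀ p : k[X], aeval w p ∈ k⟮w⟯ := fun p ↦
    (mem_adjoin_simple_iff k _).2 ⟨p, 1, by simp⟩
  rw [Derivation.leibniz_div, derivation_aeval_of_const D hD, derivation_aeval_of_const D hD]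
  simp only [smul_eq_mul]
  exact mul_mem (pow_mem (inv_mem (hmem _)) _)
    (sub_mem (mul_mem (hmem _) (mul_mem (hmem _) hDw)) (mul_mem (hmem _) (mul_mem (hmem _) hDw)))

/-- If the `cᵢ` are constants linearly independent over `ℚ` and `∑ cᵢ Duᵢ/uᵢ + Dv = 0` in a field
that is finite over `k(w)` for every nonconstant `w`, then all the `uᵢ` are constants. -/
theorem derivation_eq_zero_of_sum_logDeriv_eq_zero [CharZero k] {R : Type*} [CommRing R]
    [Algebra R M] (D : Derivation R M M) (hD : ∀ a, D (algebraMap k M a) = 0)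
    (hfin : ∀ w : M, D w ≠ 0 → FiniteDimensional k⟮w⟯ M)
    {ι : Type*} [Fintype ι] {c : ι → k} (hc : LinearIndependent ℚ c) {u : ι → M}
    (hu : ∀ i, u i ≠ 0) {v : M}
    (h : ∑ i, algebraMap k M (c i) * (D (u i) / u i) + D v = 0) (i : ι) : D (u i) = 0 := by
  by_contra hi
  set w := u i with hwi
  have := hfin w hi
  set δ : Derivation R M M := (D w)⁻¹ • D with hδ
  have hδk : ∀ a, δ (algebraMap k M a) = 0 := fun a ↦ by simp [hδ, hD]
  have hδw : δ w = 1 := by simp [hδ, hi]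
  have hw : Transcendental k w := fun hw ↦
    hi (derivation_eq_zero_of_isAlgebraic D hD hw)
  have hδh : ∑ i, algebraMap k M (c i) * (δ (u i) / u i) + δ v = 0 := by
    have := congrArg ((D w)⁻¹ * ·) h
    simp only [mul_add, Finset.mul_sum, mul_zero] at this
    rw [← this]
    congr 1
    refine Finset.sum_congr rfl fun j _ ↦ ?_
    simp only [hδ, Derivation.coe_smul, Pi.smul_apply, smul_eq_mul]
    ring
  have hstab := derivation_mem_adjoin_simple δ hδk (hδw ▸ one_mem k⟮w⟯)
  have hcompat := algebraMap_restrictDerivation δ k⟮w⟯ hstab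
  set δ₀ := restrictDerivation δ k⟮w⟯ hstab with hδ₀
  have : CharZero M := charZero_of_injective_algebraMap (algebraMap k M).injective
  have : CharZero k⟮w⟯ := charZero_of_injective_algebraMap (algebraMap k k⟮w⟯).injective
  set nm : ι → k⟮w⟯ := fun j ↦ Algebra.norm k⟮w⟯ (u j) with hnm
  have hnm0 : ∀ j, (nm j : M) ≠ 0 := fun j ↦ by
    have : nm j ≠ 0 := Algebra.norm_ne_zero_iff.2 (hu j)
    simpa using this
  have htr : ∑ j, algebraMap k M (c j) * (δ (nm j) / nm j) +
      δ (Algebra.trace k⟮w⟯ M v : k⟮w⟯) = 0 := by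
    have h1 := congrArg (fun z ↦ ((Algebra.trace k⟮w⟯ M z : k⟮w⟯) : M)) hδh
    simp only [map_add, map_sum, map_zero] at h1
    have h2 : Algebra.trace k⟮w⟯ M (δ v) = δ₀ (Algebra.trace k⟮w⟯ M v) :=
      trace_derivation δ₀ (δ.restrictScalars ℤ) hcompat v
    have h3 : ∀ j, Algebra.trace k⟮w⟯ M (algebraMap k M (c j) * (δ (u j) / u j)) =
        algebraMap k k⟮w⟯ (c j) * (δ₀ (nm j) / nm j) := by
      intro j
      rw [IsScalarTower.algebraMap_apply k k⟮w⟯ M, ← Algebra.smul_def, map_smul, smul_eq_mul]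
      congr 1
      exact trace_derivation_div δ₀ (δ.restrictScalars ℤ) hcompat (hu j)
    simp only [h2, h3] at h1
    rw [ZeroMemClass.coe_zero] at h1
    rw [← h1]
    push_cast
    rfl
  have hord : ∀ j, ∃ (n : ℤ) (r : M), (r ≠ 0 ∧ r ∈ regularAtZero hw ∧ r⁻¹ ∈ regularAtZero hw ∧
      (nm j : M) = w ^ n * r) ∧ (j = i → n = Module.finrank k⟮w⟯ M) := by
    intro j
    by_cases hj : j = i
    · refine ⟨Module.finrank k⟮w⟯ M, 1, ⟨one_ne_zero, one_mem _, by simp [one_mem], ?_⟩,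
        fun _ ↦ rfl⟩
      have : u j = algebraMap k⟮w⟯ M (AdjoinSimple.gen k w) := by rw [hj]; rfl
      simp only [hnm]
      rw [this, Algebra.norm_algebraMap]
      simp
    · obtain ⟨n, r, h⟩ := exists_eq_zpow_mul_regularAtZero hw (nm j).2 (hnm0 j)
      exact ⟨n, r, h, fun h ↦ absurd h hj⟩
  choose n r hnr hni using hord
  have hsum := sum_mul_order_eq_zero hw δ hδk hδw c n r (fun j ↦ (hnr j).1)
    (fun j ↦ (hnr j).2.1) (fun j ↦ (hnr j).2.2.1) (Algebra.trace k⟮w⟯ M v : k⟮w⟯).2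
    (by simpa only [← (hnr _).2.2.2] using htr)
  have hz := Fintype.linearIndependent_iff.1 hc (fun j ↦ (n j : ℚ)) (by
    rw [← hsum]
    refine Finset.sum_congr rfl fun j _ ↦ ?_
    rw [Rat.smul_def, Rat.cast_intCast, mul_comm]) i
  rw [hni i rfl] at hz
  have : Module.finrank k⟮w⟯ M ≠ 0 := Module.finrank_pos.ne'
  exact this (by exact_mod_cast hz)

end Residues

section Constants

open IntermediateField

variable {R k M : Type*} [CommRing R] [Field k] [Field M] [Algebra R M] [Algebra k M]

lemma isAlgebraic_adjoin_simple_of_transcendental (x : M) [Algebra.IsAlgebraic k⟮x⟯ M] {w : M}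
    (hw : Transcendental k w) : Algebra.IsAlgebraic k⟮w⟯ M := by
  have hle : Algebra.trdeg k M ≤ 1 := by
    have : Algebra.IsAlgebraic (Algebra.adjoin k {x}) M :=
      isAlgebraic_adjoin_iff_top.1 inferInstance
    simpa using Algebra.IsAlgebraic.trdeg_le_cardinalMk k {x} (A := M)
  have h := AlgebraicIndependent.isTranscendenceBasis_of_lift_trdeg_le_of_finite
    (algebraicIndependent_unique_type_iff (ι := Unit) (x := fun _ ↦ w) |>.2 hw) (by simpa using hle)
  have h' := h.isAlgebraic_field
  rwa [Set.range_const] at h'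

lemma derivation_algebraMap_adjoin_simple_eq_zero (D : Derivation R M M)
    (hD : ∀ a, D (algebraMap k M a) = 0) {y : M} (hy : D y = 0) (a : k⟮y⟯) :
    D (algebraMap k⟮y⟯ M a) = 0 := by
  obtain ⟨p, q, h⟩ := (mem_adjoin_simple_iff k _).1 a.2
  rw [IntermediateField.algebraMap_apply, h, Derivation.leibniz_div,
    derivation_aeval_of_const D hD, derivation_aeval_of_const D hD, hy]
  simp

/-- If `M` is algebraic over `k(x)`, then a derivation with `D x ≠ 0` that vanishes on `k` only
vanishes on elements algebraic over `k`. -/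
lemma isAlgebraic_of_derivation_eq_zero [CharZero k] (D : Derivation R M M)
    (hD : ∀ a, D (algebraMap k M a) = 0) {x : M} [Algebra.IsAlgebraic k⟮x⟯ M] (hx : D x ≠ 0)
    {f : M} (hf : D f = 0) : IsAlgebraic k f := by
  by_contra hft
  have := isAlgebraic_adjoin_simple_of_transcendental x hft
  exact hx (derivation_eq_zero_of_isAlgebraic D (F := k⟮f⟯)
    (derivation_algebraMap_adjoin_simple_eq_zero D hD hf)
    (Algebra.IsAlgebraic.isAlgebraic x))

variable [CharZero k] (x y : M) [hM : Algebra.IsAlgebraic k⟮y, x⟯ M]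

instance isAlgebraic_adjoin_simple_adjoin_simple : Algebra.IsAlgebraic k⟮y⟯⟮x⟯ M := by
  have : Algebra.IsAlgebraic (k⟮y⟯⟮x⟯.restrictScalars k) M := by
    rw [adjoin_simple_adjoin_simple]
    exact hM
  exact this

lemma exists_algebraMap_eq_of_isAlgebraic {k N : Type*} [Field k] [IsAlgClosed k] [Field N]
    [Algebra k N] {a : N} (ha : IsAlgebraic k a) : ∃ b, algebraMap k N b = a := by
  have h : a ∈ algebraicClosure k N := mem_algebraicClosure_iff.2 ha
  rwa [eq_bot_of_isAlgClosed_of_isAlgebraic (algebraicClosure k N), mem_bot] at h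

/-- The constants of an algebraic extension of `k(x, y)` are the constants of `k`. -/
theorem mem_range_algebraMap_of_derivation_eq_zero [IsAlgClosed k] (DX DY : Derivation R M M)
    (hXk : ∀ a, DX (algebraMap k M a) = 0) (hYk : ∀ a, DY (algebraMap k M a) = 0)
    (hXx : DX x = 1) (hXy : DX y = 0) (hYy : DY y = 1) {f : M} (hfX : DX f = 0) (hfY : DY f = 0) :
    ∃ a, algebraMap k M a = f := by
  have hk₁ := derivation_algebraMap_adjoin_simple_eq_zero DX hXk hXy
  have : CharZero k⟮y⟯ := charZero_of_injective_algebraMap (algebraMap k k⟮y⟯).injective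
  have hf : IsIntegral k⟮y⟯ f := (isAlgebraic_of_derivation_eq_zero DX hk₁ (x := x)
    (by simp [hXx]) hfX).isIntegral
  have hL := derivation_mem_adjoin_simple DY hYk (w := y) (hYy ▸ one_mem k⟮y⟯)
  have hgen : k⟮AdjoinSimple.gen k y⟯ = ⊤ := by
    apply lift_injective k⟮y⟯
    rw [lift_adjoin_simple, AdjoinSimple.coe_gen, lift_top]
  have : Algebra.IsAlgebraic k⟮AdjoinSimple.gen k y⟯ k⟮y⟯ := by
    rw [hgen]
    exact ⟨fun a ↦ isAlgebraic_algebraMap (⟨a, mem_top⟩ : (⊤ : IntermediateField k k⟮y⟯))⟩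
  have hcoeff : ∀ i, (minpoly k⟮y⟯ f).coeff i ∈ (algebraMap k k⟮y⟯).range := by
    intro i
    have h := derivation_coeff_minpoly (restrictDerivation DY k⟮y⟯ hL) (DY.restrictScalars ℤ)
      (algebraMap_restrictDerivation DY k⟮y⟯ hL) (g := f) (h := 0) hf (by simpa using hfY) i
    have h' : IsAlgebraic k ((minpoly k⟮y⟯ f).coeff i) :=
      isAlgebraic_of_derivation_eq_zero (restrictDerivation DY k⟮y⟯ hL)
        (x := AdjoinSimple.gen k y) (fun a ↦ Subtype.ext (hYk a))
        (fun h0 ↦ one_ne_zero (hYy.symm.trans (congrArg Subtype.val h0))) (by simpa using h)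
    exact exists_algebraMap_eq_of_isAlgebraic h'
  obtain ⟨p, hp⟩ := (mem_map_range (algebraMap k k⟮y⟯)).2 hcoeff
  refine exists_algebraMap_eq_of_isAlgebraic ⟨p, ?_, ?_⟩
  · rintro rfl
    exact minpoly.ne_zero hf (by simpa using hp.symm)
  · rw [← aeval_map_algebraMap k⟮y⟯]
    exact (congrArg (aeval f) hp).trans (minpoly.aeval k⟮y⟯ f)

include x in
theorem derivation_eq_zero_of_sum_logDeriv_eq_zero_of_isAlgebraic [Algebra.EssFiniteType k M]
    (D : Derivation R M M) (hD : ∀ a, D (algebraMap k M a) = 0) (hy : D y = 0)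
    {ι : Type*} [Fintype ι] {c : ι → k} (hc : LinearIndependent ℚ c) {u : ι → M}
    (hu : ∀ i, u i ≠ 0) {v : M}
    (h : ∑ i, algebraMap k M (c i) * (D (u i) / u i) + D v = 0) (i : ι) : D (u i) = 0 := by
  have : CharZero k⟮y⟯ := charZero_of_injective_algebraMap (algebraMap k k⟮y⟯).injective
  have hDy := derivation_algebraMap_adjoin_simple_eq_zero D hD hy
  refine derivation_eq_zero_of_sum_logDeriv_eq_zero D hDy (fun w hw ↦ ?_)
    (c := fun i ↦ algebraMap k k⟮y⟯ (c i)) ?_ hu (v := v) h i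
  · have hwt : Transcendental k⟮y⟯ w := fun h ↦ hw (derivation_eq_zero_of_isAlgebraic D hDy h)
    have := isAlgebraic_adjoin_simple_of_transcendental x hwt
    have := Algebra.EssFiniteType.of_comp k k⟮y⟯ M
    have := Algebra.EssFiniteType.of_comp k⟮y⟯ k⟮y⟯⟮w⟯ M
    exact Algebra.finite_of_essFiniteType_of_isAlgebraic
  · exact hc.map_injOn ((algebraMap k k⟮y⟯).toRatAlgHom.toLinearMap)
      ((algebraMap k k⟮y⟯).injective.injOn)

end Constants

section Relations

open IntermediateField

section Generic

variable {R F M : Type*} [CommRing R] [Field F] [Field M] [Algebra R F] [Algebra R M]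
  [Algebra F M] [Algebra.IsAlgebraic F M]

lemma derivation_comm [CharZero F] {Dx Dy : Derivation R F F} {DX DY : Derivation R M M}
    (hX : ∀ a, DX (algebraMap F M a) = algebraMap F M (Dx a))
    (hY : ∀ a, DY (algebraMap F M a) = algebraMap F M (Dy a))
    (hcomm : ∀ a, Dx (Dy a) = Dy (Dx a)) (z : M) : DX (DY z) = DY (DX z) := by
  have h := derivation_eq_zero_of_isAlgebraic (F := F) ⁅DX, DY⁆
    (fun a ↦ by simp [Derivation.commutator_apply, hX, hY, hcomm])
    (Algebra.IsAlgebraic.isAlgebraic z)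
  rwa [Derivation.commutator_apply, sub_eq_zero] at h

lemma derivation_eq_zero_of_coeff_minpoly [CharZero F] {D₀ : Derivation R F F}
    {D : Derivation R M M}
    (hD : ∀ a, D (algebraMap F M a) = algebraMap F M (D₀ a)) {z : M}
    (h : ∀ i, D₀ ((minpoly F z).coeff i) = 0) : D z = 0 := by
  have hz : IsIntegral F z := Algebra.IsIntegral.isIntegral z
  have h1 := derivation_aeval_eq_sum D₀ D hD (minpoly F z) z
  have h2 : aeval z (derivative (minpoly F z)) * D z = 0 := by
    rw [minpoly.aeval, map_zero] at h1
    rw [h1, derivative_apply, sum_over_range _ (by simp), map_sum, Finset.sum_mul]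
    refine Finset.sum_congr rfl fun i _ ↦ ?_
    simp [h]
    ring
  exact (mul_eq_zero.1 h2).resolve_left
    (((minpoly.irreducible hz).separable).aeval_derivative_ne_zero (minpoly.aeval F z))

/-- If the first integrals of `P dx + Q dy` in the base field are constants, then so are its
algebraic first integrals. -/
lemma derivation_eq_zero_of_first_integral [CharZero F] {Dx Dy : Derivation R F F}
    {DX DY : Derivation R M M}
    (hX : ∀ a, DX (algebraMap F M a) = algebraMap F M (Dx a))
    (hY : ∀ a, DY (algebraMap F M a) = algebraMap F M (Dy a)) {P Q : F}
    (hPQ : ∀ a, Q * Dx a - P * Dy a = 0 → Dx a = 0 ∧ Dy a = 0) {z : M}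
    (hz : algebraMap F M Q * DX z - algebraMap F M P * DY z = 0) : DX z = 0 ∧ DY z = 0 := by
  have h i : Dx ((minpoly F z).coeff i) = 0 ∧ Dy ((minpoly F z).coeff i) = 0 := by
    apply hPQ
    have := derivation_coeff_minpoly (Q • Dx.restrictScalars ℤ - P • Dy.restrictScalars ℤ)
      (algebraMap F M Q • DX.restrictScalars ℤ - algebraMap F M P • DY.restrictScalars ℤ)
      (fun a ↦ by simp [hX, hY, -algebraMap_smul]) (g := z) (h := 0)
      (Algebra.IsIntegral.isIntegral z)
      (by simpa [-algebraMap_smul] using hz) i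
    simpa using this
  exact ⟨derivation_eq_zero_of_coeff_minpoly hX fun i ↦ (h i).1,
    derivation_eq_zero_of_coeff_minpoly hY fun i ↦ (h i).2⟩

/-- If `g (P dx + Q dy)` is closed and the algebraic first integrals of `P dx + Q dy` are constants
of the base field, then a power of `g` lies in the base field. -/
lemma exists_algebraMap_eq_pow_of_closed {Dx Dy : Derivation R F F} {DX DY : Derivation R M M}
    (hX : ∀ a, DX (algebraMap F M a) = algebraMap F M (Dx a))
    (hY : ∀ a, DY (algebraMap F M a) = algebraMap F M (Dy a)) {P Q : F}
    (hPQ : ∀ z : M, algebraMap F M Q * DX z - algebraMap F M P * DY z = 0 →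
      ∃ a, algebraMap F M a = z)
    {g : M} (hg : g ≠ 0) (hclosed : DX (g * algebraMap F M Q) = DY (g * algebraMap F M P)) :
    ∃ b, algebraMap F M b = g ^ (minpoly F g).natDegree := by
  have hgi : IsIntegral F g := Algebra.IsIntegral.isIntegral g
  set X₀ : Derivation ℤ F F := Q • Dx.restrictScalars ℤ - P • Dy.restrictScalars ℤ with hX₀
  set X : Derivation ℤ M M :=
    algebraMap F M Q • DX.restrictScalars ℤ - algebraMap F M P • DY.restrictScalars ℤ with hXdef
  have hX' : ∀ a, X (algebraMap F M a) = algebraMap F M (X₀ a) := fun a ↦ by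
    simp [hXdef, hX₀, hX, hY, -algebraMap_smul]
  have hXg : X g = algebraMap F M (Dy P - Dx Q) * g := by
    rw [Derivation.leibniz, Derivation.leibniz, hX, hY] at hclosed
    simp only [hXdef, Derivation.sub_apply, Derivation.smul_apply, Derivation.restrictScalars_apply,
      smul_eq_mul, map_sub] at hclosed ⊢
    linear_combination hclosed
  have ha := derivation_coeff_minpoly X₀ X hX' hgi hXg 0
  set n := (minpoly F g).natDegree with hn
  set a := (minpoly F g).coeff 0 with ha_def
  have ha0 : a ≠ 0 := minpoly.coeff_zero_ne_zero hgi hg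
  have ha0' : algebraMap F M a ≠ 0 := by simpa using ha0
  have hn0 : 0 < n := minpoly.natDegree_pos hgi
  obtain ⟨b, hb⟩ := hPQ (g ^ n / algebraMap F M a) (by
    suffices X (g ^ n / algebraMap F M a) = 0 by simpa [hXdef, -algebraMap_smul] using this
    have h1 : g ^ n = g ^ (n - 1) * g := by rw [← pow_succ, Nat.sub_add_cancel hn0]
    rw [Derivation.leibniz_div, Derivation.leibniz_pow, hXg, hX', ha, h1]
    simp only [smul_eq_mul, nsmul_eq_mul, Nat.cast_zero, sub_zero, map_mul, map_natCast]
    ring)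
  exact ⟨b * a, by rw [map_mul, hb, div_mul_cancel₀ _ ha0']⟩

end Generic

section Rotation

variable {F M : Type*} [Field F] [Field M] [Algebra F M] [FiniteDimensional F M]

/-- A radical generator can be multiplied by any root of unity. -/
lemma exists_algHom_eq_mul {g : M} (hg : F⟮g⟯ = ⊤) {b : F}
    (hb : algebraMap F M b = g ^ Module.finrank F M) {ζ : F} (hζ : ζ ^ Module.finrank F M = 1) :
    ∃ σ : M →ₐ[F] M, σ g = algebraMap F M ζ * g := by
  have hgi : IsIntegral F g := Algebra.IsIntegral.isIntegral g
  have hn : (minpoly F g).natDegree = Module.finrank F M := by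
    rw [← adjoin.finrank hgi, hg, finrank_top']
  set n := Module.finrank F M
  have hn0 : n ≠ 0 := Module.finrank_pos.ne'
  have hp : minpoly F g = X ^ n - C b :=
    (eq_of_monic_of_dvd_of_natDegree_le (minpoly.monic hgi) (monic_X_pow_sub_C b hn0)
      (minpoly.dvd F g (by simp [hb])) (by rw [natDegree_X_pow_sub_C, hn])).symm
  let pb := PowerBasis.ofAdjoinEqTop hgi ((adjoin_simple_eq_top_iff_of_isAlgebraic
    hgi.isAlgebraic).1 hg)
  have hgen : pb.gen = g := PowerBasis.ofAdjoinEqTop_gen ..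
  have hroot : aeval (algebraMap F M ζ * g) (minpoly F pb.gen) = 0 := by
    rw [hgen, hp]
    rw [map_sub, map_pow, aeval_X, aeval_C, mul_pow, ← map_pow, hζ, hb, map_one, one_mul, sub_self]
  exact ⟨pb.lift _ hroot, (congrArg _ hgen.symm).trans (pb.lift_gen _ hroot)⟩

end Rotation

lemma linearIndependent_append_mul_of_subsingleton {n : ℕ} (hn : 3 ≤ n) {ζ : ℂ}
    (hζ : IsPrimitiveRoot ζ n) {c : Fin 1 → ℂ} (hc : LinearIndependent ℚ c) :
    LinearIndependent ℚ (Fin.append c fun i ↦ ζ * c i) := by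
  have h : Fin.append c (fun i ↦ ζ * c i) = ![c 0, ζ * c 0] := by
    ext i
    fin_cases i <;> rfl
  have hc0 := hc.ne_zero 0
  rw [h, LinearIndependent.pair_iff]
  intro s t hst
  have h1 : (s + t * ζ : ℂ) = 0 := by
    refine (mul_eq_zero.1 ?_).resolve_right hc0
    rw [← hst, Rat.smul_def, Rat.smul_def]
    ring
  have ht : t = 0 := by
    by_contra ht
    have ht' : (t : ℂ) ≠ 0 := by exact_mod_cast ht
    have hq : ζ = ((-s / t : ℚ) : ℂ) := by
      push_cast
      field_simp
      linear_combination h1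
    set q : ℚ := -s / t
    have hq1 : q ^ 2 = 1 := by
      have := hζ.norm'_eq_one (by omega)
      rw [hq, Complex.norm_ratCast] at this
      rw [← sq_abs]
      have : |q| = 1 := by exact_mod_cast this
      simp [this]
    have := Nat.le_of_dvd two_pos (hζ.dvd_of_pow_eq_one 2 (by rw [hq]; exact_mod_cast hq1))
    omega
  refine ⟨?_, ht⟩
  simpa [ht] using h1

lemma exists_eq_mul_of_mul_sub_mul_eq_zero {M : Type*} [Field M] {P Q a b : M}
    (hPQ : ¬(P = 0 ∧ Q = 0)) (h : a * Q - b * P = 0) (hab : a ≠ 0 ∨ b ≠ 0) :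
    ∃ g ≠ 0, a = g * P ∧ b = g * Q := by
  by_cases hP : P = 0
  · have hQ : Q ≠ 0 := fun hQ ↦ hPQ ⟨hP, hQ⟩
    have ha : a = 0 := by simpa [hP, hQ] using h
    have hb : b ≠ 0 := by simpa [ha] using hab
    exact ⟨b / Q, div_ne_zero hb hQ, by simp [ha, hP], (div_mul_cancel₀ b hQ).symm⟩
  · have hb : b = a / P * Q := by
      field_simp
      linear_combination -h
    have ha : a ≠ 0 := by
      rintro rfl
      simp [hb] at hab
    exact ⟨a / P, div_ne_zero ha hP, (div_mul_cancel₀ a hP).symm, hb⟩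

section PrelleSingerForm

variable {F M : Type} [Field F] [CharZero F] [Field M] [CharZero M] [Algebra F M]
  [FiniteDimensional F M]

/-- Norms and traces turn a form `∑ cᵢ duᵢ/uᵢ + dv` over `M` into one over a subfield `L`. -/
lemma psC_norm_trace {D₀ : Derivation ℚ F F} {D : Derivation ℚ M M}
    (hD : ∀ a, D (algebraMap F M a) = algebraMap F M (D₀ a)) (L : IntermediateField F M) {m : ℕ}
    (c : Fin m → F) {u : Fin m → M} (hu : ∀ i, u i ≠ 0) (v : M) :
    psC D (fun i ↦ algebraMap F M (c i)) (fun i ↦ (Algebra.norm L (u i) : M))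
      (Algebra.trace L M v : L) =
        (Algebra.trace L M (psC D (fun i ↦ algebraMap F M (c i)) u v) : L) := by
  have hL := derivation_mem_intermediateField D₀ D hD L
  have hcompat := algebraMap_restrictDerivation D L hL
  set δ := restrictDerivation D L hL
  have : CharZero L := charZero_of_injective_algebraMap (algebraMap F L).injective
  have h1 : Algebra.trace L M (D v) = δ (Algebra.trace L M v) :=
    trace_derivation δ (D.restrictScalars ℤ) hcompat v
  have h2 : ∀ j, Algebra.trace L M (algebraMap F M (c j) * (D (u j) / u j)) =
      algebraMap F L (c j) * (δ (Algebra.norm L (u j)) / Algebra.norm L (u j)) := by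
    intro j
    rw [IsScalarTower.algebraMap_apply F L M, ← Algebra.smul_def, map_smul, smul_eq_mul]
    congr 1
    exact trace_derivation_div δ (D.restrictScalars ℤ) hcompat (hu j)
  simp only [psC, map_add, map_sum, h1, h2]
  push_cast
  rfl

lemma psC_algHom {D₀ : Derivation ℚ F F} {D : Derivation ℚ M M}
    (hD : ∀ a, D (algebraMap F M a) = algebraMap F M (D₀ a)) (σ : M →ₐ[F] M) {m : ℕ}
    (c : Fin m → F) (u : Fin m → M) (v : M) :
    psC D (fun i ↦ algebraMap F M (c i)) (fun i ↦ σ (u i)) (σ v) =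
      σ (psC D (fun i ↦ algebraMap F M (c i)) u v) := by
  simp [psC, algHom_derivation D₀ D hD]

lemma derivation_psC_comm {DX DY : Derivation ℚ M M} (hcomm : ∀ z, DX (DY z) = DY (DX z)) {m : ℕ}
    {c : Fin m → M} (hX : ∀ i, DX (c i) = 0) (hY : ∀ i, DY (c i) = 0) (u : Fin m → M) (v : M) :
    DX (psC DY c u v) = DY (psC DX c u v) := by
  simp only [psC, map_add, map_sum, hcomm, Derivation.leibniz, Derivation.leibniz_div, hX, hY]
  congr 1
  refine Finset.sum_congr rfl fun i _ ↦ ?_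
  simp only [smul_eq_mul]
  ring

variable {k : Type} [Field k] [CharZero k] [Algebra k M]
  [Algebra.EssFiniteType k M]

/-- A form `∑ cᵢ duᵢ/uᵢ + dv` that is multiplied by a constant `ζ` under an endomorphism is exact
as soon as the `cᵢ` and `ζ cᵢ` are linearly independent. -/
lemma derivation_eq_zero_of_psC_eq_mul {x y : M} [Algebra.IsAlgebraic k⟮y, x⟯ M]
    {D : Derivation ℚ M M} (hDk : ∀ a, D (algebraMap k M a) = 0) (hDy : D y = 0) {m : ℕ}
    {c : Fin m → k} {ζ : k} (hc : LinearIndependent ℚ (Fin.append c fun i ↦ ζ * c i))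
    {u u' : Fin m → M} (hu : ∀ i, u i ≠ 0) (hu' : ∀ i, u' i ≠ 0) {v v' : M}
    (h : psC D (fun i ↦ algebraMap k M (c i)) u' v' =
      algebraMap k M ζ * psC D (fun i ↦ algebraMap k M (c i)) u v) (i : Fin m) : D (u i) = 0 := by
  have h0 := derivation_eq_zero_of_sum_logDeriv_eq_zero_of_isAlgebraic x y D hDk hDy
    (c := Fin.append c fun i ↦ ζ * c i) hc (u := Fin.append u' fun i ↦ (u i)⁻¹)
    (v := v' - algebraMap k M ζ * v)
    (Fin.addCases (fun i ↦ by rw [Fin.append_left]; exact hu' i)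
      fun i ↦ by rw [Fin.append_right]; exact inv_ne_zero (hu i))
    (by
      have hinv : ∀ i, D (u i)⁻¹ / (u i)⁻¹ = -(D (u i) / u i) := fun i ↦ by
        have := hu i
        rw [Derivation.leibniz_inv, smul_eq_mul]
        field_simp
      rw [← sub_eq_zero] at h
      rw [← h, Fin.sum_univ_add]
      simp only [psC, Fin.append_left, Fin.append_right, hinv, map_mul, map_sub, mul_add,
        Finset.mul_sum, Derivation.leibniz, hDk, smul_eq_mul, mul_zero, add_zero, mul_neg,
        Finset.sum_neg_distrib, mul_assoc]
      ring)
    (Fin.natAdd m i)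
  rw [Fin.append_right, Derivation.leibniz_inv] at h0
  simpa [hu i] using h0

lemma isAlgebraic_adjoin_pair_algebraMap {k F M : Type*} [Field k] [Field F] [Field M]
    [Algebra k F] [Algebra F M] [Algebra k M] [IsScalarTower k F M] [Algebra.IsAlgebraic F M]
    {x y : F} (h : k⟮x, y⟯ = ⊤) :
    Algebra.IsAlgebraic k⟮algebraMap F M x, algebraMap F M y⟯ M := by
  set L := k⟮algebraMap F M x, algebraMap F M y⟯ with hL
  have hF : ∀ a : F, algebraMap F M a ∈ L := fun a ↦ by
    have ha : a ∈ k⟮x, y⟯ := h ▸ mem_top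
    have : algebraMap F M a ∈ k⟮x, y⟯.map (IsScalarTower.toAlgHom k F M) := ⟨a, ha, rfl⟩
    rwa [adjoin_map, Set.image_pair] at this
  let : Algebra F L := ((algebraMap F M).codRestrict L hF).toAlgebra
  have : IsScalarTower F L M := IsScalarTower.of_algebraMap_eq fun _ ↦ rfl
  exact Algebra.IsAlgebraic.tower_top (K := F) L

/-- Suppose `∑ cᵢ duᵢ/uᵢ + dv = g (P dx + Q dy)` with `M = F(g)` and that the first integrals
of `P dx + Q dy` in `F = ℂ(x, y)` are constant. If the `cᵢ` and `ζ cᵢ` are independent for every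
root of unity `ζ` of order at least three, then `M` is quadratic over `F`. -/
theorem finrank_eq_two_of_psC_eq_mul [Algebra ℂ F] [Algebra ℂ M] [IsScalarTower ℂ F M]
    {x y : F} {Dx Dy : Derivation ℚ F F} {DX DY : Derivation ℚ M M}
    (hX : ∀ a, DX (algebraMap F M a) = algebraMap F M (Dx a))
    (hY : ∀ a, DY (algebraMap F M a) = algebraMap F M (Dy a))
    (hxx : Dx x = 1) (hxy : Dx y = 0) (hyx : Dy x = 0) (hyy : Dy y = 1)
    (hDxC : ∀ z : ℂ, Dx (algebraMap ℂ F z) = 0) (hDyC : ∀ z : ℂ, Dy (algebraMap ℂ F z) = 0)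
    (hcomm : ∀ a, Dx (Dy a) = Dy (Dx a)) (hgen : ℂ⟮x, y⟯ = ⊤) {P Q : F} (hω : ¬(P = 0 ∧ Q = 0))
    (hPQ : ∀ a, Q * Dx a - P * Dy a = 0 → Dx a = 0 ∧ Dy a = 0)
    (hn : 1 < Module.finrank F M) {m : ℕ} {c : Fin m → ℂ} {u : Fin m → M} {v g : M}
    (hu : ∀ i, u i ≠ 0) (hg : g ≠ 0) (htop : F⟮g⟯ = ⊤)
    (hgX : psC DX (fun i ↦ algebraMap F M (algebraMap ℂ F (c i))) u v = g * algebraMap F M P)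
    (hgY : psC DY (fun i ↦ algebraMap F M (algebraMap ℂ F (c i))) u v = g * algebraMap F M Q)
    (hc : ∀ n : ℕ, 3 ≤ n → ∀ ζ : ℂ, IsPrimitiveRoot ζ n →
      LinearIndependent ℚ (Fin.append c fun i ↦ ζ * c i)) :
    Module.finrank F M = 2 := by
  have hX0 : ∀ z : ℂ, DX (algebraMap ℂ M z) = 0 := fun z ↦ by
    rw [IsScalarTower.algebraMap_apply ℂ F M, hX, hDxC, map_zero]
  have hY0 : ∀ z : ℂ, DY (algebraMap ℂ M z) = 0 := fun z ↦ by
    rw [IsScalarTower.algebraMap_apply ℂ F M, hY, hDyC, map_zero]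
  have hxy_alg := isAlgebraic_adjoin_pair_algebraMap (M := M) hgen
  have hyx_alg := isAlgebraic_adjoin_pair_algebraMap (M := M) (Set.pair_comm x y ▸ hgen)
  have : Algebra.EssFiniteType ℂ F := fg_top_iff.1 (by
    classical exact ⟨{x, y}, by simpa using hgen⟩)
  have : Algebra.EssFiniteType ℂ M := Algebra.EssFiniteType.comp ℂ F M
  have hFI : ∀ z : M, algebraMap F M Q * DX z - algebraMap F M P * DY z = 0 →
      DX z = 0 ∧ DY z = 0 := fun z ↦ derivation_eq_zero_of_first_integral hX hY hPQ
  have hdeg : (minpoly F g).natDegree = Module.finrank F M := by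
    rw [← adjoin.finrank (Algebra.IsIntegral.isIntegral g), htop, finrank_top']
  obtain ⟨b, hb⟩ := exists_algebraMap_eq_pow_of_closed hX hY (fun z hz ↦ by
    obtain ⟨hzX, hzY⟩ := hFI z hz
    obtain ⟨a, ha⟩ := mem_range_algebraMap_of_derivation_eq_zero (algebraMap F M x)
      (algebraMap F M y) DX DY hX0 hY0 (by simp [hX, hxx]) (by simp [hX, hxy])
      (by simp [hY, hyy]) hzX hzY
    exact ⟨algebraMap ℂ F a, by rw [← IsScalarTower.algebraMap_apply, ha]⟩) hg (by
    rw [← hgX, ← hgY]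
    exact derivation_psC_comm (derivation_comm hX hY hcomm)
      (fun i ↦ by rw [hX, hDxC, map_zero]) (fun i ↦ by rw [hY, hDyC, map_zero]) u v)
  rw [hdeg] at hb
  by_contra hn2
  have hζ := Complex.isPrimitiveRoot_exp (Module.finrank F M) (by omega)
  set ζ := Complex.exp (2 * Real.pi * Complex.I / Module.finrank F M)
  obtain ⟨σ, hσ⟩ := exists_algHom_eq_mul htop hb (ζ := algebraMap ℂ F ζ)
    (by rw [← map_pow, hζ.pow_eq_one, map_one])
  have hind := hc _ (by omega) ζ hζ
  have huX := derivation_eq_zero_of_psC_eq_mul (x := algebraMap F M x) hX0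
    (y := algebraMap F M y) (by simp [hX, hxy]) hind hu (u' := fun i ↦ σ (u i)) (v' := σ v)
    (by simpa using hu) (v := v) (by
      simp only [IsScalarTower.algebraMap_apply ℂ F M]
      rw [psC_algHom hX, hgX, map_mul, hσ, AlgHom.commutes, mul_assoc])
  have huY := derivation_eq_zero_of_psC_eq_mul (x := algebraMap F M y) hY0
    (y := algebraMap F M x) (by simp [hY, hyx]) hind hu (u' := fun i ↦ σ (u i)) (v' := σ v)
    (by simpa using hu) (v := v) (by
      simp only [IsScalarTower.algebraMap_apply ℂ F M]
      rw [psC_algHom hY, hgY, map_mul, hσ, AlgHom.commutes, mul_assoc])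
  simp only [psC, huX, huY, zero_div, mul_zero, Finset.sum_const_zero, zero_add] at hgX hgY
  obtain ⟨hvX, hvY⟩ := hFI v (by rw [hgX, hgY]; ring)
  rw [hvX, zero_eq_mul] at hgX
  rw [hvY, zero_eq_mul] at hgY
  exact hω ⟨by simpa [hg] using hgX, by simpa [hg] using hgY⟩

end PrelleSingerForm

end Relations

end PrelleSinger

/-- Corollary. If ω is exceptional with minimal extension L and the
ℚ-linearly independent constants c₁,…,c_m are such that c₁,…,c_m,ζc₁,…,ζc_m are
ℚ-linearly independent for every primitive n-th root of unity ζ with n ≥ 3 — in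
particular whenever m = 1 — then [L : K] = 2. -/
theorem minimal_extension_is_quadratic
    {K : Type} [Field K] [CharZero K] [Algebra ℂ K]
    (x y : K) (Dx Dy : Derivation ℚ K K)
    (hxx : Dx x = 1) (hxy : Dx y = 0) (hyx : Dy x = 0) (hyy : Dy y = 1)
    (hDxC : ∀ z : ℂ, Dx (algebraMap ℂ K z) = 0)
    (hDyC : ∀ z : ℂ, Dy (algebraMap ℂ K z) = 0)
    (hcomm : ∀ a : K, Dx (Dy a) = Dy (Dx a))
    (hgen : IntermediateField.adjoin ℂ {x, y} = ⊤)
    (hind : AlgebraicIndependent ℂ ![x, y])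
    (P Q : K) (hω : ¬ (P = 0 ∧ Q = 0))
    (hexc : IsExceptional Dx Dy P Q)
    {E : DiffExt K Dx Dy}
    (hn : 1 < Module.finrank K E.M)
    (hmin : ∀ L' : IntermediateField K E.M, RelIn E P Q L' → L' = ⊤)
    (m : ℕ) (c : Fin m → ℂ) (u : Fin m → E.M) (v : E.M)
    (hPS : PSRel E.DX E.DY (algebraMap K E.M P) (algebraMap K E.M Q)
      (fun i => algebraMap K E.M (algebraMap ℂ K (c i))) u v)
    (hcind : LinearIndependent ℚ c)
    (hhyp : (∀ n' : ℕ, 3 ≤ n' → ∀ ζ : ℂ, IsPrimitiveRoot ζ n' →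
        LinearIndependent ℚ (Fin.append c (fun i => ζ * c i))) ∨ m = 1) :
    Module.finrank K E.M = 2 := by
  obtain ⟨hu, hrel, hne⟩ := hPS
  have := E.finite
  let : Algebra ℂ E.M := ((algebraMap K E.M).comp (algebraMap ℂ K)).toAlgebra
  have : IsScalarTower ℂ K E.M := IsScalarTower.of_algebraMap_eq fun _ ↦ rfl
  obtain ⟨g, hg, hgX, hgY⟩ := PrelleSinger.exists_eq_mul_of_mul_sub_mul_eq_zero
    (P := algebraMap K E.M P) (Q := algebraMap K E.M Q) (by simpa using hω) hrel hne
  have htop : IntermediateField.adjoin K {g} = ⊤ := by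
    apply hmin
    have hgL := IntermediateField.mem_adjoin_simple_self K g
    set L := IntermediateField.adjoin K {g}
    have hX := PrelleSinger.psC_norm_trace E.extX L (fun i ↦ algebraMap ℂ K (c i)) hu v
    have hY := PrelleSinger.psC_norm_trace E.extY L (fun i ↦ algebraMap ℂ K (c i)) hu v
    have htr : ∀ a : K, ((Algebra.trace L E.M (g * algebraMap K E.M a) : L) : E.M) =
        Module.finrank L E.M * (g * algebraMap K E.M a) := by
      intro a
      have : g * algebraMap K E.M a = algebraMap L E.M (⟨g, hgL⟩ * algebraMap K L a) := rfl
      rw [this, Algebra.trace_algebraMap, nsmul_eq_mul]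
      push_cast
      rfl
    rw [hgX, htr] at hX
    rw [hgY, htr] at hY
    have hd : (Module.finrank L E.M : E.M) ≠ 0 := by exact_mod_cast Module.finrank_pos.ne'
    refine ⟨m, c, fun i ↦ (Algebra.norm L (u i) : L), (Algebra.trace L E.M v : L),
      fun i ↦ SetLike.coe_mem _, SetLike.coe_mem _, fun i ↦ ?_, ?_, ?_⟩
    · have : Algebra.norm L (u i) ≠ 0 := Algebra.norm_ne_zero_iff.2 (hu i)
      simpa using this
    · rw [hX, hY]
      ring
    · rw [hX, hY]
      simpa [hd, hg, or_iff_not_and_not] using hω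
  refine PrelleSinger.finrank_eq_two_of_psC_eq_mul E.extX E.extY hxx hxy hyx hyy hDxC hDyC hcomm
    hgen hω (fun a ha ↦ ?_) hn hu hg htop hgX hgY fun n hn ζ hζ ↦ ?_
  · by_contra h
    refine hexc.2 ⟨0, ![], ![], a, fun i ↦ i.elim0, ?_, ?_⟩
    · simpa [psC, mul_comm] using ha
    · simpa [psC, or_iff_not_and_not] using h
  · rcases hhyp with h | rfl
    · exact h n hn ζ hζ
    · exact PrelleSinger.linearIndependent_append_mul_of_subsingleton hn hζ hcind
end
end
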